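/- arXiv:1609.02250 — 2 statements merged into one kernel-verified Lean document; each statement's English description precedes it below -/
import Mathlib

section
/- For every integer s ≥ 1, the GL_5-invariants of (QP_5)_{7·2^s − 5} vanish: every homogeneous polynomial f of degree 7·2^s − 5 in P_5 such that g·f − f is hit for every g in GL_5(F_2) is itself hit. -/
open MvPolynomial

noncomputable section

/-- The polynomial algebra `P_5 = F_2[x_1,...,x_5]`. -/
abbrev P5 : Type := MvPolynomial (Fin 5) (ZMod 2)

/-- The total Steenrod square: the `F_2`-algebra endomorphism with `Sq (x_i) = x_i + x_i ^ 2`. -/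
def Sq : P5 →ₐ[ZMod 2] P5 := aeval fun i => X i + X i ^ 2

/-- `f` (homogeneous of degree `n`) is hit if it is the degree-`n` homogeneous component of
`Sq g` for some `g` all of whose homogeneous components have degree `< n`. -/
def IsHit (n : ℕ) (f : P5) : Prop :=
  ∃ g : P5, (∀ m, n ≤ m → homogeneousComponent m g = 0) ∧
    f = homogeneousComponent n (Sq g)

/-- The subspace of hit polynomials of degree `n`. -/
def hitSpan (n : ℕ) : Submodule (ZMod 2) P5 :=
  Submodule.span (ZMod 2) {f : P5 | IsHit n f}

/-- The action of `GL_5(F_2)` on `P_5` by linear substitution of the variables. -/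
def actGL (g : Matrix.GeneralLinearGroup (Fin 5) (ZMod 2)) : P5 →ₐ[ZMod 2] P5 :=
  aeval fun i => ∑ j, ((g : Matrix (Fin 5) (Fin 5) (ZMod 2)) i j) • X j

/-- `wt d i` is the `(i+1)`-st entry `ω_{i+1}` of the weight vector of the monomial with
exponent vector `d`, i.e. the number of `j` such that bit `i` of `d j` is `1`. -/
def wt (d : Fin 5 →₀ ℕ) (i : ℕ) : ℕ :=
  (Finset.univ.filter fun j : Fin 5 => Nat.testBit (d j) i).card

/-- The weight vector of the exponent vector `d` equals the (finitely supported) list `w`. -/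
def hasWt (d : Fin 5 →₀ ℕ) (w : List ℕ) : Prop :=
  ∀ i, wt d i = w.getD i 0

/-- The weight vector of `d` is strictly smaller than `w` in left lexicographic order. -/
def wtLt (d : Fin 5 →₀ ℕ) (w : List ℕ) : Prop :=
  ∃ i, (∀ j, j < i → wt d j = w.getD j 0) ∧ wt d i < w.getD i 0

/-- `P_5^-(ω)`: the span of degree-`n` monomials whose weight vector is `< w`. -/
def PMinus (n : ℕ) (w : List ℕ) : Submodule (ZMod 2) P5 :=
  Submodule.span (ZMod 2)
    {x : P5 | ∃ d : Fin 5 →₀ ℕ, x = monomial d 1 ∧ (∑ j, d j) = n ∧ wtLt d w}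

/-- `P_5(ω)`: the span of degree-`n` monomials whose weight vector is `≤ w`. -/
def PLe (n : ℕ) (w : List ℕ) : Submodule (ZMod 2) P5 :=
  Submodule.span (ZMod 2)
    {x : P5 | ∃ d : Fin 5 →₀ ℕ, x = monomial d 1 ∧ (∑ j, d j) = n ∧ (wtLt d w ∨ hasWt d w)}

/-- The monomial `x_1^a x_2^b x_3^c x_4^d x_5^e`. -/
def mon (a b c d e : ℕ) : P5 :=
  X 0 ^ a * X 1 ^ b * X 2 ^ c * X 3 ^ d * X 4 ^ e

namespace Steenrod

section Hit

variable {σ τ K L : Type*} [CommRing K] [CommRing L]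

theorem algHom_sub_mem_pow (S : MvPolynomial σ K →ₐ[K] MvPolynomial σ K)
    (hS : ∀ i, S (X i) - X i ∈ idealOfVars σ K ^ 2) (n : ℕ) (p : MvPolynomial σ K)
    (hp : p ∈ idealOfVars σ K ^ n) : S p - p ∈ idealOfVars σ K ^ (n + 1) := by
  have h0 : ∀ r : MvPolynomial σ K, S r - r ∈ idealOfVars σ K := by
    intro r
    induction r using MvPolynomial.induction_on with
    | C a =>
      have : S (C a) = C a := S.commutes a
      simp [this]
    | add p q hp hq =>
      have : S (p + q) - (p + q) = (S p - p) + (S q - q) := by rw [map_add]; ring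
      rw [this]; exact Ideal.add_mem _ hp hq
    | mul_X p i hp =>
      have : S (p * X i) - p * X i = S p * (S (X i) - X i) + (S p - p) * X i := by
        rw [map_mul]; ring
      rw [this]
      exact Ideal.add_mem _ (Ideal.mul_mem_left _ _ (Ideal.pow_le_self two_ne_zero (hS i)))
        (Ideal.mul_mem_right _ _ hp)
  have h1 : ∀ r ∈ idealOfVars σ K, S r - r ∈ idealOfVars σ K ^ 2 := by
    intro r hr
    induction hr using Submodule.span_induction with
    | mem x hx => obtain ⟨i, rfl⟩ := hx; exact hS i
    | zero => simp
    | add p q _ _ hp hq =>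
      have : S (p + q) - (p + q) = (S p - p) + (S q - q) := by rw [map_add]; ring
      rw [this]; exact Ideal.add_mem _ hp hq
    | smul a x hx hx' =>
      have : S (a • x) - a • x = S a * (S x - x) + (S a - a) * x := by
        rw [smul_eq_mul, map_mul]; ring
      rw [this, sq]
      exact Ideal.add_mem _ (Ideal.mul_mem_left _ _ (sq (idealOfVars σ K) ▸ hx'))
        (Ideal.mul_mem_mul (h0 a) hx)
  induction n generalizing p with
  | zero => simpa using h0 p
  | succ n ih =>
    rw [pow_succ] at hp
    induction hp using Submodule.mul_induction_on' with
    | mem_mul_mem a ha b hb =>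
      have : S (a * b) - a * b = (S a - a) * (S b - b) + (S a - a) * b + a * (S b - b) := by
        rw [map_mul]; ring
      rw [this]
      refine Ideal.add_mem _ (Ideal.add_mem _ ?_ ?_) ?_
      · have := Ideal.mul_mem_mul (ih a ha) (h1 b hb)
        rw [← pow_add] at this
        exact Ideal.pow_le_pow_right (by omega) this
      · rw [pow_succ]; exact Ideal.mul_mem_mul (ih a ha) hb
      · have := Ideal.mul_mem_mul ha (h1 b hb)
        rwa [← pow_add] at this
    | add p _ q _ hp hq =>
      have : S (p + q) - (p + q) = (S p - p) + (S q - q) := by rw [map_add]; ring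
      rw [this]; exact Ideal.add_mem _ hp hq

theorem homogeneousComponent_eq_zero_of_mem_pow {m n : ℕ} (h : n < m) {p : MvPolynomial σ K}
    (hp : p ∈ idealOfVars σ K ^ m) : homogeneousComponent n p = 0 := by
  rw [mem_pow_idealOfVars_iff'] at hp
  ext d
  rw [coeff_homogeneousComponent]
  split_ifs with hd
  · rw [hp d (by omega), coeff_zero]
  · rw [coeff_zero]

theorem mem_pow_of_isHomogeneous {n : ℕ} {p : MvPolynomial σ K} (hp : p.IsHomogeneous n) :
    p ∈ idealOfVars σ K ^ n := by
  rw [mem_pow_idealOfVars_iff']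
  intro d hd
  exact hp.coeff_eq_zero hd.ne

/-- The hit polynomials of degree `n` with respect to an algebra endomorphism. -/
def hits (S : MvPolynomial σ K →ₐ[K] MvPolynomial σ K) (n : ℕ) : Submodule K (MvPolynomial σ K) :=
  LinearMap.range (homogeneousComponent n ∘ₗ (S.toLinearMap - LinearMap.id))

theorem component_mem_hits (S : MvPolynomial σ K →ₐ[K] MvPolynomial σ K) (n : ℕ)
    (p : MvPolynomial σ K) : homogeneousComponent n (S p - p) ∈ hits S n := ⟨p, rfl⟩

theorem map_mem_hits {F : Type*} [FunLike F (MvPolynomial σ K) (MvPolynomial τ L)]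
    [AddMonoidHomClass F (MvPolynomial σ K) (MvPolynomial τ L)] (φ : F)
    {S : MvPolynomial σ K →ₐ[K] MvPolynomial σ K} {S' : MvPolynomial τ L →ₐ[L] MvPolynomial τ L}
    {m n : ℕ} (hc : ∀ p, homogeneousComponent n (φ p) = φ (homogeneousComponent m p))
    (hS : ∀ p, φ (S p) = S' (φ p)) {p : MvPolynomial σ K} (hp : p ∈ hits S m) :
    φ p ∈ hits S' n := by
  obtain ⟨g, rfl⟩ := hp
  refine ⟨φ g, ?_⟩
  simp only [LinearMap.comp_apply, LinearMap.sub_apply, LinearMap.id_apply,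
    AlgHom.toLinearMap_apply]
  rw [← hc, map_sub φ, hS]

theorem homogeneousComponent_map {F : Type*} [FunLike F (MvPolynomial σ K) (MvPolynomial τ L)]
    [AddMonoidHomClass F (MvPolynomial σ K) (MvPolynomial τ L)] (φ : F)
    (hφ : ∀ (n : ℕ) (p : MvPolynomial σ K), p.IsHomogeneous n → (φ p).IsHomogeneous n) (n : ℕ)
    (p : MvPolynomial σ K) :
    homogeneousComponent n (φ p) = φ (homogeneousComponent n p) := by
  conv_lhs => rw [← sum_homogeneousComponent p, map_sum, map_sum]
  simp_rw [homogeneousComponent_of_mem (hφ _ _ (homogeneousComponent_isHomogeneous _ p))]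
  rw [Finset.sum_ite_eq]
  split_ifs with h
  · rfl
  · rw [homogeneousComponent_eq_zero n p (by simpa [Nat.lt_succ_iff] using h), map_zero]

theorem aeval_homogeneousComponent {R : Type*} [CommRing R] [Algebra R K]
    (g : σ → MvPolynomial τ K) (hg : ∀ i, (g i).IsHomogeneous 1) (n : ℕ) (p : MvPolynomial σ R) :
    homogeneousComponent n (aeval g p) = aeval g (homogeneousComponent n p) :=
  homogeneousComponent_map (aeval g) (fun m q hq => by simpa using hq.aeval g hg) n p

end Hit

theorem Sq_X (i : Fin 5) : Sq (X i) = X i + X i ^ 2 := by simp [Sq]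

theorem X_pow_mem {σ K : Type*} [CommRing K] (i : σ) (n : ℕ) :
    (X i ^ n : MvPolynomial σ K) ∈ idealOfVars σ K ^ n :=
  Ideal.pow_mem_pow (Ideal.subset_span (Set.mem_range_self i)) n

theorem Sq_sub_mem_pow (n : ℕ) (p : P5) (hp : p ∈ idealOfVars (Fin 5) (ZMod 2) ^ n) :
    Sq p - p ∈ idealOfVars (Fin 5) (ZMod 2) ^ (n + 1) :=
  algHom_sub_mem_pow Sq (fun i => by rw [Sq_X, add_sub_cancel_left]; exact X_pow_mem i 2) n p hp

theorem isHit_iff (n : ℕ) (f : P5) : IsHit n f ↔ f ∈ hits Sq n := by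
  constructor
  · rintro ⟨g, hg, rfl⟩
    refine ⟨g, ?_⟩
    simp [hg n le_rfl]
  · rintro ⟨w, rfl⟩
    have key : w - ∑ m ∈ Finset.range n, homogeneousComponent m w ∈
        idealOfVars (Fin 5) (ZMod 2) ^ n := by
      rw [mem_pow_idealOfVars_iff']
      intro d hd
      rw [coeff_sub, coeff_sum]
      simp_rw [coeff_homogeneousComponent]
      rw [Finset.sum_ite_eq, if_pos (by simpa using hd), sub_self]
    have hg : ∀ m, n ≤ m →
        homogeneousComponent m (∑ m ∈ Finset.range n, homogeneousComponent m w) = 0 := by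
      intro m hm
      rw [map_sum]
      refine Finset.sum_eq_zero fun k hk => ?_
      rw [homogeneousComponent_of_mem (homogeneousComponent_isHomogeneous k w),
        if_neg (by rw [Finset.mem_range] at hk; omega)]
    refine ⟨_, hg, ?_⟩
    have h := homogeneousComponent_eq_zero_of_mem_pow n.lt_succ_self (Sq_sub_mem_pow n _ key)
    simp only [map_sub, sub_eq_zero] at h
    have h' := hg n le_rfl
    simp only [LinearMap.comp_apply, LinearMap.sub_apply, LinearMap.id_apply,
      AlgHom.toLinearMap_apply, map_sub]
    rw [h'] at h
    linear_combination h

section Kameko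

/-- The Kameko map, sending a monomial with odd exponents `2 * d i + 1` to the monomial with
exponents `d i` and the other monomials to zero. -/
def kameko : P5 →ₗ[ZMod 2] P5 :=
  (basisMonomials (Fin 5) (ZMod 2)).constr (ZMod 2) fun d =>
    if ∀ i, Odd (d i) then monomial (d.mapRange (· / 2) rfl) 1 else 0

theorem kameko_monomial (d : Fin 5 →₀ ℕ) (a : ZMod 2) :
    kameko (monomial d a) =
      if ∀ i, Odd (d i) then monomial (d.mapRange (· / 2) rfl) a else 0 := by
  have h : (monomial d a : P5) = a • basisMonomials (Fin 5) (ZMod 2) d := by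
    rw [coe_basisMonomials, smul_monomial, smul_eq_mul, mul_one]
  rw [h, map_smul, kameko, Module.Basis.constr_basis, smul_ite, smul_zero, smul_monomial,
    smul_eq_mul, mul_one]

theorem kameko_mul_sq (u v : P5) : kameko (u * v ^ 2) = kameko u * v := by
  induction v using MvPolynomial.induction_on' with
  | add v w hv hw => rw [CharTwo.add_sq, mul_add, map_add, hv, hw, mul_add]
  | monomial e b =>
    induction u using MvPolynomial.induction_on' with
    | add u w hu hw => rw [add_mul, map_add, hu, hw, map_add, add_mul]
    | monomial d a =>
      have hb : b ^ 2 = b := by revert b; decide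
      rw [monomial_pow, monomial_mul, kameko_monomial, kameko_monomial, hb]
      have h : (∀ i, Odd ((d + 2 • e) i)) ↔ ∀ i, Odd (d i) := by
        refine forall_congr' fun i => ?_
        rw [Finsupp.add_apply, Finsupp.smul_apply, smul_eq_mul, Nat.odd_add]
        simp
      simp_rw [h, ite_mul, zero_mul, monomial_mul]
      split_ifs
      · congr 2
        ext i
        simp only [Finsupp.mapRange_apply, Finsupp.add_apply, Finsupp.smul_apply, smul_eq_mul]
        omega
      · rfl

theorem prod_X_eq_monomial {ι : Type*} (s : Finset ι) (f : ι → Fin 5) :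
    (∏ i ∈ s, X (f i) : P5) = monomial (∑ i ∈ s, Finsupp.single (f i) 1) 1 := by
  rw [monomial_sum_one]; rfl

theorem kameko_prod_X (s : Finset (Fin 5)) :
    kameko (∏ i ∈ s, X i) = if s = Finset.univ then 1 else 0 := by
  rw [prod_X_eq_monomial s fun i => i, kameko_monomial]
  have h : ∀ i, (∑ j ∈ s, Finsupp.single j 1 : Fin 5 →₀ ℕ) i = if i ∈ s then 1 else 0 := by
    intro i
    simp [Finsupp.finsetSum_apply, Finsupp.single_apply]
  simp_rw [h]
  have h2 : (∀ i, Odd (if i ∈ s then 1 else 0)) ↔ s = Finset.univ := by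
    rw [Finset.eq_univ_iff_forall]
    refine forall_congr' fun i => ?_
    split_ifs with hi <;> simp [hi]
  simp_rw [h2]
  refine if_congr Iff.rfl ?_ rfl
  have : (Finsupp.mapRange (· / 2) rfl (∑ j ∈ s, Finsupp.single j 1 : Fin 5 →₀ ℕ)) = 0 := by
    ext i
    rw [Finsupp.mapRange_apply, h]
    split_ifs <;> rfl
  rw [this]; rfl

/-- Every monomial is the product of a square-free monomial and a square. -/
theorem monomial_eq_prod_X_mul_sq (d : Fin 5 →₀ ℕ) :
    (monomial d 1 : P5) = (∏ i with Odd (d i), X i) * monomial (d.mapRange (· / 2) rfl) 1 ^ 2 := by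
  rw [prod_X_eq_monomial _ fun i => i, monomial_pow, monomial_mul, one_pow, one_mul]
  refine congrArg (fun e => (monomial e 1 : P5)) ?_
  ext i
  simp only [Finsupp.add_apply, Finsupp.finsetSum_apply, Finsupp.single_apply,
    Finset.sum_ite_eq', Finset.mem_filter, Finset.mem_univ, true_and, Finsupp.smul_apply,
    Finsupp.mapRange_apply, smul_eq_mul]
  split_ifs with h
  · have := Nat.odd_iff.mp h; omega
  · have := Nat.not_odd_iff.mp h; omega

theorem kameko_algHom (φ : P5 →ₐ[ZMod 2] P5)
    (h : ∀ s : Finset (Fin 5), kameko (φ (∏ i ∈ s, X i)) = if s = Finset.univ then 1 else 0)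
    (p : P5) : kameko (φ p) = φ (kameko p) := by
  induction p using MvPolynomial.induction_on' with
  | add p q hp hq => rw [map_add, map_add, hp, hq, map_add, map_add]
  | monomial d a =>
    have h1 : (monomial d a : P5) = a • monomial d 1 := by
      rw [smul_monomial, smul_eq_mul, mul_one]
    rw [h1]
    simp only [map_smul]
    congr 1
    rw [monomial_eq_prod_X_mul_sq, map_mul, map_pow, kameko_mul_sq, kameko_mul_sq, h,
      kameko_prod_X]
    split_ifs <;> simp

theorem kameko_Sq (p : P5) : kameko (Sq p) = Sq (kameko p) := by
  refine kameko_algHom Sq (fun s => ?_) p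
  simp_rw [map_prod, Sq_X]
  rw [Finset.prod_add, map_sum]
  simp_rw [Finset.prod_pow, kameko_mul_sq, kameko_prod_X, ite_mul, zero_mul, one_mul]
  rw [Finset.sum_ite_eq']
  by_cases hs : s = Finset.univ
  · simp [hs]
  · simp [hs]

theorem kameko_eq_zero_of_isHomogeneous {n : ℕ} (hn : n < 5) {p : P5} (hp : p.IsHomogeneous n) :
    kameko p = 0 := by
  rw [p.as_sum, map_sum]
  refine Finset.sum_eq_zero fun d hd => ?_
  rw [kameko_monomial, if_neg]
  intro h
  have h1 : d.degree = n := by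
    by_contra h2
    exact (mem_support_iff.mp hd) (hp.coeff_eq_zero h2)
  rw [Finsupp.degree_eq_sum] at h1
  have h2 : ∑ _i : Fin 5, 1 ≤ ∑ i, d i := Finset.sum_le_sum fun i _ => (h i).pos
  simp at h2
  omega

theorem kameko_prod_X_apply (f : Fin 5 → Fin 5) :
    kameko (∏ i, X (f i)) = if f.Bijective then 1 else 0 := by
  split_ifs with h
  · rw [h.prod_comp fun i => (X i : P5), kameko_prod_X, if_pos rfl]
  · rw [prod_X_eq_monomial, kameko_monomial, if_neg]
    intro h2
    apply h
    rw [← Finite.surjective_iff_bijective]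
    intro j
    by_contra hj
    push Not at hj
    have := h2 j
    simp [Finsupp.finsetSum_apply, hj] at this

theorem actGL_X (g : Matrix.GeneralLinearGroup (Fin 5) (ZMod 2)) (i : Fin 5) :
    actGL g (X i) = ∑ j, ((g : Matrix (Fin 5) (Fin 5) (ZMod 2)) i j) • X j := by
  simp [actGL]

theorem isHomogeneous_actGL_X (g : Matrix.GeneralLinearGroup (Fin 5) (ZMod 2)) (i : Fin 5) :
    (∑ j, ((g : Matrix (Fin 5) (Fin 5) (ZMod 2)) i j) • X j : P5).IsHomogeneous 1 :=
  IsHomogeneous.sum _ _ _ fun j _ =>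
    (homogeneousSubmodule (Fin 5) (ZMod 2) 1).smul_mem _ (isHomogeneous_X _ j)

theorem sum_prod_bijective (M : Matrix (Fin 5) (Fin 5) (ZMod 2)) :
    ∑ f : Fin 5 → Fin 5, (if f.Bijective then ∏ i, M i (f i) else 0) = M.det := by
  rw [← Matrix.det_transpose, Matrix.det_apply]
  refine (Finset.sum_of_injOn (fun σ : Equiv.Perm (Fin 5) => (σ : Fin 5 → Fin 5))
    (fun σ _ τ _ h => DFunLike.coe_injective h) (fun _ _ => Finset.mem_coe.mpr (Finset.mem_univ _))
    (fun f _ hf => ?_) fun σ _ => ?_).symm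
  · rw [if_neg]
    intro h
    exact hf ⟨Equiv.ofBijective f h, by simp, rfl⟩
  · rw [if_pos σ.bijective]
    rcases Int.units_eq_one_or (Equiv.Perm.sign σ) with h | h
    · rw [h, one_smul]
      rfl
    · rw [h, Units.neg_smul, one_smul, CharTwo.neg_eq]
      rfl

theorem kameko_actGL (g : Matrix.GeneralLinearGroup (Fin 5) (ZMod 2)) (p : P5) :
    kameko (actGL g p) = actGL g (kameko p) := by
  refine kameko_algHom (actGL g) (fun s => ?_) p
  simp_rw [map_prod, actGL_X]
  split_ifs with hs
  · subst hs
    rw [Finset.prod_univ_sum, Fintype.piFinset_univ, map_sum]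
    simp_rw [Finset.prod_smul, map_smul, kameko_prod_X_apply]
    have h1 : ∀ x : ZMod 2, x ≠ 0 → x = 1 := by decide
    have h2 : (g : Matrix (Fin 5) (Fin 5) (ZMod 2)).det = 1 := h1 _ (by
      have := (Matrix.isUnit_iff_isUnit_det _).mp g.isUnit
      exact this.ne_zero)
    have h3 : ∀ f : Fin 5 → Fin 5, (∏ i, (g : Matrix (Fin 5) (Fin 5) (ZMod 2)) i (f i)) •
        (if f.Bijective then (1 : P5) else 0) =
        (if f.Bijective then ∏ i, (g : Matrix (Fin 5) (Fin 5) (ZMod 2)) i (f i) else 0) •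
          (1 : P5) := by
      intro f
      split_ifs <;> simp
    simp_rw [h3, ← Finset.sum_smul]
    rw [sum_prod_bijective, h2, one_smul]
  · refine kameko_eq_zero_of_isHomogeneous (n := ∑ i ∈ s, 1) ?_
      (IsHomogeneous.prod _ _ _ fun i _ => isHomogeneous_actGL_X g i)
    have := Finset.card_lt_card (Finset.ssubset_univ_iff.mpr hs)
    simpa using this

theorem homogeneousComponent_kameko (n : ℕ) (p : P5) :
    homogeneousComponent n (kameko p) = kameko (homogeneousComponent (2 * n + 5) p) := by
  induction p using MvPolynomial.induction_on' with
  | add p q hp hq => rw [map_add, map_add, hp, hq, map_add, map_add]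
  | monomial d a =>
    rw [homogeneousComponent_of_mem (isHomogeneous_monomial a rfl), kameko_monomial]
    split_ifs with h1 h2 h2
    · rw [homogeneousComponent_of_mem (isHomogeneous_monomial a rfl), kameko_monomial, if_pos h1,
        if_pos]
      rw [Finsupp.degree_eq_sum] at h2 ⊢
      simp only [Finsupp.mapRange_apply, Fin.sum_univ_five] at h2 ⊢
      have h3 := fun i => Nat.odd_iff.mp (h1 i)
      have := h3 0; have := h3 1; have := h3 2; have := h3 3; have := h3 4
      omega
    · rw [homogeneousComponent_of_mem (isHomogeneous_monomial a rfl), map_zero, if_neg]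
      rw [Finsupp.degree_eq_sum] at h2 ⊢
      simp only [Finsupp.mapRange_apply, Fin.sum_univ_five] at h2 ⊢
      have h3 := fun i => Nat.odd_iff.mp (h1 i)
      have := h3 0; have := h3 1; have := h3 2; have := h3 3; have := h3 4
      omega
    · rw [map_zero, kameko_monomial, if_neg h1]
    · rw [map_zero, map_zero]

end Kameko

section Grading

variable {σ K : Type*} [CommRing K]

/-- The algebra map multiplying each variable by a grading variable. -/
def toGraded : MvPolynomial σ K →ₐ[K] Polynomial (MvPolynomial σ K) :=
  aeval fun i => Polynomial.C (X i) * Polynomial.X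

theorem toGraded_X (i : σ) :
    toGraded (X i : MvPolynomial σ K) = Polynomial.C (X i) * Polynomial.X := by
  rw [toGraded, aeval_X]

theorem toGraded_of_isHomogeneous {n : ℕ} {p : MvPolynomial σ K} (hp : p.IsHomogeneous n) :
    toGraded p = Polynomial.C p * Polynomial.X ^ n := by
  rw [p.as_sum, map_sum, map_sum, Finset.sum_mul]
  refine Finset.sum_congr rfl fun d hd => ?_
  have h1 : d.degree = n := by
    by_contra h2
    exact (mem_support_iff.mp hd) (hp.coeff_eq_zero h2)
  rw [toGraded, aeval_monomial, monomial_eq (s := d), ← h1, Finsupp.degree_apply]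
  simp only [Finsupp.prod, mul_pow, Finset.prod_mul_distrib, Finset.prod_pow_eq_pow_sum, map_mul,
    map_prod, map_pow]
  rw [← mul_assoc]
  rfl

theorem toGraded_coeff (p : MvPolynomial σ K) (n : ℕ) :
    (toGraded p).coeff n = homogeneousComponent n p := by
  conv_lhs => rw [← sum_homogeneousComponent p, map_sum, Polynomial.finsetSum_coeff]
  simp_rw [toGraded_of_isHomogeneous (homogeneousComponent_isHomogeneous _ p),
    Polynomial.coeff_C_mul_X_pow]
  rw [Finset.sum_ite_eq]
  split_ifs with h
  · rfl
  · rw [homogeneousComponent_eq_zero n p (by simpa [Nat.lt_succ_iff] using h)]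

end Grading

section OneSource

theorem toGraded_Sq_monomial (d : Fin 5 →₀ ℕ) :
    (toGraded (Sq (monomial d 1))).natDegree ≤ 2 * d.degree ∧
      (toGraded (Sq (monomial d 1))).coeff (2 * d.degree) = monomial d 1 ^ 2 := by
  have hX : ∀ i, toGraded (Sq (X i)) =
      Polynomial.C (X i ^ 2) * Polynomial.X ^ 2 + Polynomial.C (X i) * Polynomial.X := by
    intro i
    rw [Sq_X, map_add, map_pow, toGraded_X, mul_pow, ← map_pow, add_comm]
  have hd : ∀ i, (toGraded (Sq (X i))).natDegree ≤ 2 := by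
    intro i
    rw [hX]
    compute_degree
  have hc : ∀ i, (toGraded (Sq (X i))).coeff 2 = X i ^ 2 := by
    intro i
    rw [hX]
    rw [Polynomial.coeff_add, Polynomial.coeff_C_mul_X_pow, Polynomial.coeff_C_mul_X]
    simp
  have hm : (monomial d 1 : P5) = ∏ i, X i ^ d i := by
    rw [monomial_eq, C_1, one_mul, Finsupp.prod_fintype _ _ fun i => pow_zero _]
  have hs : ∀ i, (toGraded (Sq (X i)) ^ d i).natDegree ≤ 2 * d i := fun i =>
    (Polynomial.natDegree_pow_le_of_le _ (hd i)).trans (mul_comm _ _).le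
  have h2 : 2 * d.degree = ∑ i, 2 * d i := by rw [Finsupp.degree_eq_sum, Finset.mul_sum]
  rw [hm, map_prod, map_prod, h2]
  simp_rw [map_pow]
  refine ⟨(Polynomial.natDegree_prod_le _ _).trans (Finset.sum_le_sum fun i _ => hs i), ?_⟩
  rw [← Finset.prod_pow]
  have key : ∀ s : Finset (Fin 5),
      (∏ i ∈ s, toGraded (Sq (X i)) ^ d i).coeff (∑ i ∈ s, 2 * d i) =
        ∏ i ∈ s, (X i ^ d i) ^ 2 := by
    intro s
    induction s using Finset.cons_induction with
    | empty => simp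
    | cons a s ha ih =>
      rw [Finset.prod_cons, Finset.prod_cons, Finset.sum_cons,
        Polynomial.coeff_mul_add_eq_of_natDegree_le (hs a)
          ((Polynomial.natDegree_prod_le _ _).trans (Finset.sum_le_sum fun i _ => hs i)), ih,
        mul_comm 2 (d a), Polynomial.coeff_pow_of_natDegree_le (hd a), hc, pow_right_comm]
  exact key _

theorem homogeneousComponent_mul_Sq_monomial {r : ℕ} {p : P5} (hp : p.IsHomogeneous r)
    (d : Fin 5 →₀ ℕ) :
    homogeneousComponent (r + 2 * d.degree) (p * Sq (monomial d 1)) = p * monomial d 1 ^ 2 := by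
  rw [← toGraded_coeff, map_mul, toGraded_of_isHomogeneous hp,
    Polynomial.coeff_mul_add_eq_of_natDegree_le (Polynomial.natDegree_C_mul_X_pow_le _ _)
      (toGraded_Sq_monomial d).1, (toGraded_Sq_monomial d).2, Polynomial.coeff_C_mul_X_pow,
    if_pos rfl]

/-- A polynomial which is sent by `Sq` to the variable `X i` up to high degree. -/
def conj (m : ℕ) (i : Fin 5) : P5 := ∑ k ∈ Finset.range m, X i ^ 2 ^ k

theorem Sq_conj (m : ℕ) (i : Fin 5) : Sq (conj m i) = X i + X i ^ 2 ^ m := by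
  induction m with
  | zero => simp [conj, CharTwo.add_self_eq_zero]
  | succ m ih =>
    rw [conj, Finset.sum_range_succ, map_add, ← conj, ih, map_pow, Sq_X, add_pow_char_pow,
      ← pow_mul, ← pow_succ']
    linear_combination CharTwo.add_self_eq_zero (X i ^ 2 ^ m : P5)

theorem mul_sq_mem_hits (B : Finset (Fin 5)) (d : Fin 5 →₀ ℕ) (m : ℕ)
    (hm : B.card + 2 * d.degree < 2 ^ m)
    (h : homogeneousComponent (B.card + 2 * d.degree)
      ((∏ i ∈ B, conj m i) * monomial d 1) = 0) :
    (∏ i ∈ B, X i) * monomial d 1 ^ 2 ∈ hits Sq (B.card + 2 * d.degree) := by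
  have hB : (∏ i ∈ B, X i : P5).IsHomogeneous B.card := by
    have := IsHomogeneous.prod B (fun i => (X i : P5)) (fun _ => 1)
      fun i _ => isHomogeneous_X (ZMod 2) i
    simpa using this
  rw [← homogeneousComponent_mul_Sq_monomial hB]
  refine ⟨(∏ i ∈ B, conj m i) * monomial d 1, ?_⟩
  simp only [LinearMap.comp_apply, LinearMap.sub_apply, LinearMap.id_apply,
    AlgHom.toLinearMap_apply, map_sub]
  rw [h, sub_zero, ← sub_eq_zero, ← map_sub]
  refine homogeneousComponent_eq_zero_of_mem_pow hm ?_
  rw [← Ideal.Quotient.eq, map_mul, map_mul, map_mul, map_prod, map_prod, map_prod]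
  simp_rw [Sq_conj, map_add, Ideal.Quotient.eq_zero_iff_mem.mpr (X_pow_mem _ (2 ^ m)), add_zero]

theorem two_pow_cases (a : ℕ) : 2 ^ a = 1 ∨ 2 ^ a = 2 ∨ ∃ b, 2 ^ a = 4 * 2 ^ b := by
  match a with
  | 0 => left; rfl
  | 1 => right; left; rfl
  | a + 2 => right; right; exact ⟨a, by ring⟩

theorem one_power_ne (s a : ℕ) : 2 ^ a ≠ 28 * 2 ^ s - 2 := by
  have := s.two_pow_pos
  obtain h | h | ⟨b, h⟩ := two_pow_cases a <;> omega

theorem three_powers_ne (s a b c : ℕ) : 2 ^ a + 2 ^ b + 2 ^ c ≠ 28 * 2 ^ s - 1 := by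
  have h1 : ∀ a, 2 ^ a + 4 ≠ 28 * 2 ^ s := by
    intro a
    obtain h | h | ⟨b, h⟩ := two_pow_cases a
    · omega
    · omega
    · obtain h | h | ⟨c, h⟩ := two_pow_cases b <;>
        obtain h' | h' | ⟨d, h'⟩ := two_pow_cases s <;> omega
  have := s.two_pow_pos
  have := h1 a
  have := h1 b
  have := h1 c
  obtain h | h | ⟨a', h⟩ := two_pow_cases a <;> obtain h' | h' | ⟨b', h'⟩ := two_pow_cases b <;>
    obtain h'' | h'' | ⟨c', h''⟩ := two_pow_cases c <;> omega

theorem homogeneousComponent_X_pow_mul (i : Fin 5) {n k m : ℕ} {p : P5} (hp : p.IsHomogeneous m)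
    (h : k + m ≠ n) : homogeneousComponent n (X i ^ k * p) = 0 := by
  have h1 := (isHomogeneous_X (ZMod 2) i).pow k |>.mul hp
  rw [homogeneousComponent_of_mem h1, if_neg (by omega)]

theorem monomial_mem_hits (s : ℕ) (d : Fin 5 →₀ ℕ) (hd : d.degree = 56 * 2 ^ s - 5)
    (hodd : ∃ i, ¬ Odd (d i)) : (monomial d 1 : P5) ∈ hits Sq (56 * 2 ^ s - 5) := by
  have hpos := s.two_pow_pos
  set B : Finset (Fin 5) := {i | Odd (d i)} with hB
  set e : Fin 5 →₀ ℕ := d.mapRange (· / 2) rfl with he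
  have hdeg : B.card + 2 * e.degree = 56 * 2 ^ s - 5 := by
    rw [← hd, hB, Finset.card_filter, Finsupp.degree_eq_sum, Finsupp.degree_eq_sum,
      Finset.mul_sum, ← Finset.sum_add_distrib]
    refine Finset.sum_congr rfl fun i _ => ?_
    rw [he, Finsupp.mapRange_apply]
    split_ifs with h
    · have := Nat.odd_iff.mp h; omega
    · have := Nat.not_odd_iff.mp h; omega
  have hcard : B.card < 5 := by
    obtain ⟨i, hi⟩ := hodd
    have : B ⊂ Finset.univ := Finset.ssubset_univ_iff.mpr fun h => hi (by
      have := h ▸ Finset.mem_univ i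
      simpa [hB] using this)
    simpa using Finset.card_lt_card this
  rw [monomial_eq_prod_X_mul_sq, ← hB, ← he, ← hdeg]
  have hm : (monomial e 1 : P5).IsHomogeneous e.degree := isHomogeneous_monomial 1 rfl
  refine mul_sq_mem_hits B e (B.card + 2 * e.degree) Nat.lt_two_pow_self ?_
  obtain h | h : B.card = 1 ∨ B.card = 3 := by omega
  · obtain ⟨i, hi⟩ := Finset.card_eq_one.mp h
    rw [h] at hdeg
    rw [h, hi, Finset.prod_singleton, conj, Finset.sum_mul, map_sum]
    refine Finset.sum_eq_zero fun a _ => homogeneousComponent_X_pow_mul i hm ?_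
    have := one_power_ne s a
    omega
  · obtain ⟨i, j, k, hij, hik, hjk, hi⟩ := Finset.card_eq_three.mp h
    rw [h] at hdeg
    rw [h, hi, Finset.prod_insert (by simp [hij, hik]), Finset.prod_insert (by simp [hjk]),
      Finset.prod_singleton, conj, conj, conj, mul_assoc, mul_assoc]
    simp_rw [Finset.sum_mul, Finset.mul_sum, map_sum]
    refine Finset.sum_eq_zero fun a _ => Finset.sum_eq_zero fun b _ =>
      Finset.sum_eq_zero fun c _ => ?_
    refine homogeneousComponent_X_pow_mul i
      (((isHomogeneous_X (ZMod 2) j).pow (2 ^ b)).mul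
        (((isHomogeneous_X (ZMod 2) k).pow (2 ^ c)).mul hm)) ?_
    have := three_powers_ne s a b c
    omega

end OneSource

theorem mem_hits_of_kameko_eq_zero (s : ℕ) {f : P5} (hf : f.IsHomogeneous (56 * 2 ^ s - 5))
    (hk : kameko f = 0) : f ∈ hits Sq (56 * 2 ^ s - 5) := by
  rw [f.as_sum]
  refine Submodule.sum_mem _ fun d hd => ?_
  have h1 : d.degree = 56 * 2 ^ s - 5 := by
    by_contra h2
    exact (mem_support_iff.mp hd) (hf.coeff_eq_zero h2)
  have h2 : (monomial d (coeff d f) : P5) = coeff d f • monomial d 1 := by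
    rw [smul_monomial, smul_eq_mul, mul_one]
  rw [h2]
  refine Submodule.smul_mem _ _ (monomial_mem_hits s d h1 ?_)
  by_contra h
  push Not at h
  have h3 : coeff (d.mapRange (· / 2) rfl) (kameko f) = coeff d f := by
    conv_lhs => rw [f.as_sum, map_sum, coeff_sum]
    rw [Finset.sum_eq_single d]
    · rw [kameko_monomial, if_pos h, coeff_monomial, if_pos rfl]
    · intro e _ he
      rw [kameko_monomial]
      split_ifs with h4
      · rw [coeff_monomial, if_neg]
        intro h5
        apply he
        ext i
        have h6 := DFunLike.congr_fun h5 i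
        simp only [Finsupp.mapRange_apply] at h6
        have := Nat.odd_iff.mp (h4 i)
        have := Nat.odd_iff.mp (h i)
        omega
      · rw [coeff_zero]
    · intro h'
      exact absurd hd h'
  rw [hk, coeff_zero] at h3
  exact (mem_support_iff.mp hd) h3.symm

theorem mem_hits_of_kameko_mem_hits (s : ℕ) {f : P5} (hf : f.IsHomogeneous (56 * 2 ^ s - 5))
    (hk : kameko f ∈ hits Sq (28 * 2 ^ s - 5)) : f ∈ hits Sq (56 * 2 ^ s - 5) := by
  have hpos := s.two_pow_pos
  obtain ⟨g, hg⟩ := hk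
  have hX : kameko (Sq (∏ i, X i)) = 1 := by rw [kameko_Sq, kameko_prod_X, if_pos rfl, map_one]
  have hX' : kameko (∏ i, X i) = 1 := by rw [kameko_prod_X, if_pos rfl]
  have h1 := component_mem_hits Sq (56 * 2 ^ s - 5) ((∏ i, X i) * g ^ 2)
  have h2 : 56 * 2 ^ s - 5 = 2 * (28 * 2 ^ s - 5) + 5 := by omega
  have h3 : kameko (homogeneousComponent (56 * 2 ^ s - 5)
      (Sq ((∏ i, X i) * g ^ 2) - (∏ i, X i) * g ^ 2)) = kameko f := by
    rw [h2, ← homogeneousComponent_kameko, map_sub, map_mul, map_pow, kameko_mul_sq,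
      kameko_mul_sq, hX, hX', one_mul, one_mul, ← hg]
    simp
  rw [← sub_add_cancel f]
  refine Submodule.add_mem _ (mem_hits_of_kameko_eq_zero s
    (hf.sub (homogeneousComponent_isHomogeneous _ _)) ?_) h1
  rw [map_sub, h3, sub_self]

/-- The Kameko induction step for the vanishing of invariants. -/
theorem mem_hits_of_invariant_succ (s : ℕ)
    (ih : ∀ f : P5, f.IsHomogeneous (28 * 2 ^ s - 5) →
      (∀ g, actGL g f - f ∈ hits Sq (28 * 2 ^ s - 5)) → f ∈ hits Sq (28 * 2 ^ s - 5))
    {f : P5} (hf : f.IsHomogeneous (56 * 2 ^ s - 5))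
    (hinv : ∀ g, actGL g f - f ∈ hits Sq (56 * 2 ^ s - 5)) : f ∈ hits Sq (56 * 2 ^ s - 5) := by
  have hpos := s.two_pow_pos
  have h2 : 56 * 2 ^ s - 5 = 2 * (28 * 2 ^ s - 5) + 5 := by omega
  refine mem_hits_of_kameko_mem_hits s hf (ih _ ?_ fun g => ?_)
  · have h3 : homogeneousComponent (2 * (28 * 2 ^ s - 5) + 5) f = f := by
      rw [homogeneousComponent_of_mem hf, if_pos h2.symm]
    rw [← h3, ← homogeneousComponent_kameko]
    exact homogeneousComponent_isHomogeneous _ _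
  · rw [← kameko_actGL, ← map_sub]
    exact map_mem_hits kameko (fun p => by rw [homogeneousComponent_kameko, h2]) kameko_Sq (hinv g)

/-- Binary search trees with natural number keys and values. -/
inductive SearchTree : Type
  | leaf : SearchTree
  | node : ℕ → ℕ → SearchTree → SearchTree → SearchTree

/-- The value stored at a key, with default value `0`. -/
def SearchTree.find (c : ℕ) (t : SearchTree) : ℕ :=
  SearchTree.rec 0 (fun k v _ _ l r => cond (Nat.beq c k) v (cond (Nat.ble c k) l r)) t

/-- Application of a function to a natural number, arranged so that kernel reduction
evaluates the number first. -/
def withNat {α : Type} (x : ℕ) (f : ℕ → α) : α :=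
  Nat.rec (f 0) (fun n _ => f (Nat.succ n)) x

/-- Application of a function to a list of natural numbers, arranged so that kernel reduction
evaluates the list first. -/
def withList {α : Type} : List ℕ → (List ℕ → α) → α
  | [], f => f []
  | x :: l, f => withNat x fun y => withList l fun m => f (y :: m)

/-- The exponents of the monomial with code `c`. -/
def digits (c : ℕ) : Fin 5 → ℕ :=
  ![c % 64, c / 64 % 64, c / 4096 % 64, c / 262144 % 64, c / 16777216]

/-- The degree of the monomial with code `c`. -/
def codeDeg (c : ℕ) : ℕ :=
  c % 64 + c / 64 % 64 + c / 4096 % 64 + c / 262144 % 64 + c / 16777216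

/-- The code of the monomial with the given exponents. -/
def code (a b c d e : ℕ) : ℕ :=
  Nat.add a (Nat.add (Nat.mul 64 b) (Nat.add (Nat.mul 4096 c)
    (Nat.add (Nat.mul 262144 d) (Nat.mul 16777216 e))))

/-- Lists of binomials `T ^ u + T ^ v`, where the degree of the monomial with code `v` exceeds
that of the monomial with code `u` by `s`. -/
inductive Binomials : Type
  | nil : Binomials
  | cons : ℕ → ℕ → ℕ → Binomials → Binomials

/-- The binomials for all the bits of the exponents. -/
def allBinomials : Binomials :=
  .cons 16 536870912 16 <| .cons 1024 32 16 <| .cons 65536 2048 16 <|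
  .cons 4194304 131072 16 <| .cons 268435456 8388608 16 <|
  .cons 8 268435456 8 <| .cons 512 16 8 <| .cons 32768 1024 8 <|
  .cons 2097152 65536 8 <| .cons 134217728 4194304 8 <|
  .cons 4 134217728 4 <| .cons 256 8 4 <| .cons 16384 512 4 <|
  .cons 1048576 32768 4 <| .cons 67108864 2097152 4 <|
  .cons 2 67108864 2 <| .cons 128 4 2 <| .cons 8192 256 2 <|
  .cons 524288 16384 2 <| .cons 33554432 1048576 2 <|
  .cons 1 33554432 1 <| .cons 64 2 1 <| .cons 4096 128 1 <|
  .cons 262144 8192 1 <| .cons 16777216 524288 1 <| .nil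

/-- The binomials for those bits which occur in the code `c`. -/
def Binomials.restrict (c : ℕ) (B : Binomials) : Binomials :=
  Binomials.rec .nil (fun u v s _ B => cond (Nat.beq (Nat.land c u) u) (.cons u v s B) B) B

/-- Codes of the terms of excess `r` in a product of binomials of total excess `t`, multiplied by a
monomial; the argument `m` is the code of the product of this monomial and the first terms. -/
def Binomials.expand (B : Binomials) : ℕ → ℕ → ℕ → List ℕ → List ℕ :=
  Binomials.rec (fun m r _ L => cond (Nat.beq r 0) (m :: L) L)
    (fun u v s _ E m r t L =>
      cond (Nat.beq r 0) (m :: L) <|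
      cond (Nat.ble r t)
        (withNat (Nat.sub t s) fun t =>
          cond (Nat.ble s r)
            (E m r t (withNat (Nat.sub r s) fun r => withNat (Nat.sub (Nat.add m v) u) fun m =>
              E m r t L))
            (E m r t L))
        L) B

/-- Codes of the terms of the twisted Steenrod operation `Sq^r` on the monomial with code `m`
of degree `t`. -/
def sqTerms (m r t : ℕ) : List ℕ := (allBinomials.restrict m).expand m r t []

/-- Exclusive or of the values of `h` along a list. -/
def xorSum (h : ℕ → ℕ) (l : List ℕ) : ℕ :=
  List.rec 0 (fun c _ x => Nat.xor (h c) x) l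

/-- Products of codes of terms of two polynomials. -/
def mulTerms (a b : List ℕ) : List ℕ := a.flatMap fun x => b.map fun y => Nat.add x y

/-- Add a term modulo two. -/
def toggle (c : ℕ) : List ℕ → List ℕ
  | [] => [c]
  | x :: l => cond (Nat.beq c x) l (x :: toggle c l)

/-- Cancel pairs of equal terms. -/
def cancel (l : List ℕ) : List ℕ := l.foldr (fun c l => withList (toggle c l) id) []

/-- Terms of the image of a square-free monomial under the circulant substitution. -/
def circLevel (c : ℕ) : List ℕ :=
  [0, 1, 2, 3, 4].foldr (fun i l => cond (Nat.beq (c / 64 ^ i % 2) 1)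
    (cancel (mulTerms [64 ^ i, 64 ^ ((i + 1) % 5), 64 ^ ((i + 2) % 5)] l)) l) [0]

/-- Terms of the image of the bit levels `≥ k` of a monomial under the circulant substitution. -/
def circTerms (c : ℕ) : ℕ → ℕ → List ℕ
  | 0, _ => [0]
  | t + 1, k => mulTerms (circLevel (c / 2 ^ k)) ((circTerms c t (k + 1)).map fun x => 2 * x)

/-- Check a predicate on all numbers at most `n`. -/
def allLE (p : ℕ → Bool) (n : ℕ) : Bool :=
  Nat.rec (p 0) (fun n q => withNat (Nat.succ n) fun m => cond (p m) q false) n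

/-- Pack a list of codes into a number. -/
def pack (l : List ℕ) : ℕ :=
  List.rec 0 (fun c _ x => Nat.add c (Nat.mul 1073741824 x)) l

/-- Data for verifying the vanishing of invariants in degree `deg`: the codes `mons` of all `size`
monomials of weight zero, of which the first `rank` ones span the others modulo hit polynomials,
the inverse `index` of `mons`, the values `dual` of functionals on monomials, and for each
monomial which is not among the first ones sources of hit polynomials. -/
structure Cert where
  deg : ℕ
  size : ℕ
  rank : ℕ
  mons : ℕ
  index : SearchTree
  dual : SearchTree
  rows : List (List ℕ)

/-- The code of the monomial with index `i`. -/
def Cert.mon (D : Cert) (i : ℕ) : ℕ := Nat.mod (Nat.shiftRight D.mons (30 * i)) 1073741824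

/-- The bits of this number are the values of the functionals on the monomial with code `c`. -/
def dualValue (t : SearchTree) (c : ℕ) : ℕ :=
  withNat c fun c => withNat (Nat.mod c 31) fun r =>
    cond (Nat.beq r 0) (t.find c) (cond (Nat.beq r 15) (t.find c) 0)

/-- Check that the index of the code `c` is correct. -/
def Cert.indexed (D : Cert) (c : ℕ) : Bool :=
  withNat (D.index.find c) fun i =>
  cond (Nat.blt i D.size) (Nat.beq (D.mon i) c) false

/-- Check a predicate of the exponents `b`, `c`, `d`, `e` and the complementary degree for all
exponents with sum at most `n`. -/
def allExponents (n : ℕ) (p : ℕ → ℕ → ℕ → ℕ → ℕ → Bool) : Bool :=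
  allLE (fun e => withNat (Nat.sub n e) fun n =>
    allLE (fun d => withNat (Nat.sub n d) fun n =>
      allLE (fun c => withNat (Nat.sub n c) fun n =>
        allLE (fun b => withNat (Nat.sub n b) fun n => p n b c d e) n) n) n) n

/-- Check that all monomials of weight zero have an index. -/
def Cert.checkComplete (D : Cert) : Bool :=
  allExponents D.deg fun a b c d e =>
    withNat (code a b c d e) fun m => cond (Nat.beq (Nat.mod m 31) 0) (D.indexed m) true

/-- Check that the functionals vanish on the terms of Steenrod operations of a monomial `m`
of positive excess `a - x`. -/
def dualCheckAt (n : ℕ) (t : SearchTree) (a b c d e x : ℕ) : Bool :=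
  cond (Nat.blt x a)
    (withNat (code x b c d e) fun m => withNat (Nat.sub a x) fun r =>
      Nat.beq (xorSum (dualValue t) (sqTerms m r (Nat.sub n r))) 0) true

/-- Check that the functionals vanish on hit polynomials of degree `n`. -/
def dualCheck (n : ℕ) (t : SearchTree) : Bool :=
  allExponents n fun a b c d e =>
    withNat (Nat.mod (code 0 b c d e) 31) fun y =>
      cond (withNat (Nat.mod (Nat.sub 31 y) 31) fun x => dualCheckAt n t a b c d e x)
        (withNat (Nat.mod (Nat.sub 46 y) 31) fun x => dualCheckAt n t a b c d e x) false

def Cert.checkDual (D : Cert) : Bool :=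
  withNat D.deg fun n => dualCheck n D.dual

/-- Check that a source yields a hit polynomial of the right degree whose terms have an index. -/
def Cert.checkHit (D : Cert) (m : ℕ) : Bool :=
  withNat (codeDeg m) fun t => cond (Nat.blt t D.deg)
    (withNat (Nat.sub D.deg t) fun r => (sqTerms m r t).all D.indexed) false

/-- The set of indices of the terms of the hit polynomial with source `m`. -/
def Cert.hitRow (D : Cert) (m : ℕ) : ℕ :=
  withNat (codeDeg m) fun t => withNat (Nat.sub D.deg t) fun r =>
  xorSum (fun c => Nat.pow 2 (D.index.find c)) (sqTerms m r t)

/-- Check that the leading indices of the rows are consecutive. -/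
def Cert.checkRows (D : Cert) : ℕ → List (List ℕ) → Bool
  | i, [] => Nat.beq i D.size
  | i, r :: l => cond (r.all D.checkHit)
      (cond (Nat.beq (Nat.log2 (xorSum D.hitRow r)) i)
        (withNat (Nat.succ i) fun i => D.checkRows i l) false) false

/-- Check that the functionals are dual to the images of the first monomials under the circulant
substitution minus the identity. -/
def Cert.checkRank (D : Cert) : Bool :=
  allLE (fun j => cond (Nat.blt j D.rank)
    (withNat (D.mon j) fun m =>
    withList (circLevel m) fun P =>
    withList ((circTerms m 5 1).map fun x => Nat.mul 2 x) fun Q =>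
    Nat.beq (Nat.xor (xorSum (fun x => xorSum (fun y => dualValue D.dual (Nat.add x y)) Q) P)
      (dualValue D.dual m)) (Nat.pow 2 j)) true) D.rank

section Semantics

theorem withNat_eq {α : Type} (x : ℕ) (f : ℕ → α) : withNat x f = f x := by
  cases x <;> rfl

theorem withList_eq {α : Type} (l : List ℕ) (f : List ℕ → α) : withList l f = f l := by
  induction l generalizing f with
  | nil => rfl
  | cons x l ih => rw [withList, withNat_eq, ih]

theorem beq_eq_false {a b : ℕ} (h : a ≠ b) : Nat.beq a b = false :=
  Bool.not_eq_true _ ▸ fun h' => h (Nat.eq_of_beq_eq_true h')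

theorem ble_eq_false {a b : ℕ} (h : ¬ a ≤ b) : Nat.ble a b = false := by
  rw [← Bool.not_eq_true]
  exact fun h' => h (Nat.le_of_ble_eq_true h')

theorem cond_eq_true_iff (a b : Bool) : cond a b false = true ↔ a = true ∧ b = true := by
  cases a <;> simp

theorem allLE_iff (p : ℕ → Bool) (n : ℕ) : allLE p n = true ↔ ∀ i ≤ n, p i = true := by
  induction n with
  | zero => simp [allLE]
  | succ n ih =>
    have : allLE p (n + 1) = cond (p (n + 1)) (allLE p n) false := by
      rw [allLE]; exact withNat_eq _ _
    rw [this, cond_eq_true_iff, ih]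
    constructor
    · rintro ⟨h1, h2⟩ i hi
      rcases Nat.le_succ_iff.mp hi with h | rfl
      · exact h2 i h
      · exact h1
    · exact fun h => ⟨h _ le_rfl, fun i hi => h i (by omega)⟩

theorem allExponents_imp {n : ℕ} {p : ℕ → ℕ → ℕ → ℕ → ℕ → Bool} (h : allExponents n p = true)
    {a b c d e : ℕ} (hn : a + b + c + d + e = n) : p a b c d e = true := by
  simp only [allExponents, withNat_eq, allLE_iff] at h
  have := h e (by omega) d (by simp only [Nat.sub_eq]; omega) c (by simp only [Nat.sub_eq]; omega)
    b (by simp only [Nat.sub_eq]; omega)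
  have h2 : (((n.sub e).sub d).sub c).sub b = a := by simp only [Nat.sub_eq]; omega
  rwa [h2] at this

theorem code_eq (a b c d e : ℕ) :
    code a b c d e = a + 64 * b + 4096 * c + 262144 * d + 16777216 * e := by
  simp only [code, Nat.add_eq, Nat.mul_eq]; ring

/-- The code of a vector of exponents. -/
def encode (d : Fin 5 → ℕ) : ℕ := code (d 0) (d 1) (d 2) (d 3) (d 4)

theorem encode_digits (c : ℕ) : encode (digits c) = c := by
  rw [encode, code_eq]
  simp only [digits, Matrix.cons_val]
  omega

theorem digits_encode {d : Fin 5 → ℕ} (hd : ∀ i, d i < 64) : digits (encode d) = d := by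
  have h0 := hd 0
  have h1 := hd 1
  have h2 := hd 2
  have h3 := hd 3
  rw [encode, code_eq]
  funext i
  fin_cases i <;> simp only [digits, Matrix.cons_val, Fin.zero_eta, Fin.mk_one, Fin.reduceFinMk] <;>
    omega

theorem codeDeg_eq (c : ℕ) : codeDeg c = ∑ i, digits c i := by
  simp [codeDeg, digits, Fin.sum_univ_five]

variable {K : Type*} [CommRing K]

/-- The sum of the powers of a variable with the given exponents. -/
def termSum (K : Type*) [CommRing K] (l : List ℕ) : Polynomial K :=
  (l.map fun c => Polynomial.X ^ c).sum

@[simp] theorem termSum_nil : termSum K [] = 0 := rfl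

@[simp] theorem termSum_cons (c : ℕ) (l : List ℕ) :
    termSum K (c :: l) = Polynomial.X ^ c + termSum K l := rfl

theorem termSum_append (l m : List ℕ) : termSum K (l ++ m) = termSum K l + termSum K m := by
  simp [termSum]

theorem termSum_mulTerms (a b : List ℕ) : termSum K (mulTerms a b) = termSum K a * termSum K b := by
  induction a with
  | nil => simp [mulTerms]
  | cons x a ih =>
    have h : termSum K (b.map fun y => Nat.add x y) = Polynomial.X ^ x * termSum K b := by
      clear ih
      induction b with
      | nil => simp
      | cons y b ih =>
        rw [List.map_cons, termSum_cons, termSum_cons, ih, Nat.add_eq, pow_add, mul_add]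
    rw [mulTerms, List.flatMap_cons, termSum_append, h, termSum_cons, add_mul, ← ih, mulTerms]

/-- A bit of a number as an element of a ring. -/
def bit (K : Type*) [CommRing K] (j v : ℕ) : K := if v.testBit j then 1 else 0

theorem bit_zero (j : ℕ) : bit K j 0 = 0 := by simp [bit]

theorem xorSum_cons (h : ℕ → ℕ) (c : ℕ) (l : List ℕ) :
    xorSum h (c :: l) = h c ^^^ xorSum h l := rfl

/-- The linear functional on polynomials with values on powers of the variable given by bits. -/
def bitFunctional (K : Type*) [CommRing K] (j : ℕ) (h : ℕ → ℕ) : Polynomial K →ₗ[K] K :=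
  (Polynomial.basisMonomials K).constr K fun c => bit K j (h c)

theorem bitFunctional_X_pow (j : ℕ) (h : ℕ → ℕ) (c : ℕ) :
    bitFunctional K j h (Polynomial.X ^ c) = bit K j (h c) := by
  have : (Polynomial.X ^ c : Polynomial K) = Polynomial.basisMonomials K c := by
    rw [Polynomial.coe_basisMonomials, Polynomial.X_pow_eq_monomial]
  rw [this, bitFunctional, Module.Basis.constr_basis]

section CharTwo

variable [CharP K 2]

theorem termSum_toggle (c : ℕ) (l : List ℕ) :
    termSum K (toggle c l) = Polynomial.X ^ c + termSum K l := by
  induction l with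
  | nil => simp [toggle]
  | cons x l ih =>
    rw [toggle]
    by_cases h : c = x
    · subst h
      simp only [Nat.beq_refl, cond_true, termSum_cons]
      rw [← add_assoc, CharTwo.add_self_eq_zero, zero_add]
    · rw [beq_eq_false h, cond_false, termSum_cons, ih, termSum_cons]
      ring

theorem termSum_cancel (l : List ℕ) : termSum K (cancel l) = termSum K l := by
  rw [cancel]
  induction l with
  | nil => rfl
  | cons x l ih => rw [List.foldr_cons, withList_eq, id, termSum_toggle, ih, termSum_cons]

theorem termSum_map_two_mul (l : List ℕ) :
    termSum K (l.map fun x => 2 * x) = termSum K l ^ 2 := by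
  induction l with
  | nil => simp
  | cons x l ih =>
    rw [List.map_cons, termSum_cons, ih, termSum_cons, CharTwo.add_sq, ← pow_mul, mul_comm]

/-- The image of a variable under the circulant substitution. -/
def circ (K : Type*) [CommRing K] (i : ℕ) : Polynomial K :=
  Polynomial.X ^ 64 ^ i + Polynomial.X ^ 64 ^ ((i + 1) % 5) + Polynomial.X ^ 64 ^ ((i + 2) % 5)

theorem termSum_circLevel (c : ℕ) :
    termSum K (circLevel c) = ∏ i ∈ Finset.range 5, circ K i ^ (c / 64 ^ i % 2) := by
  have key : ∀ (i : ℕ) (l : List ℕ), termSum K (cond (Nat.beq (c / 64 ^ i % 2) 1)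
      (cancel (mulTerms [64 ^ i, 64 ^ ((i + 1) % 5), 64 ^ ((i + 2) % 5)] l)) l) =
        circ K i ^ (c / 64 ^ i % 2) * termSum K l := by
    intro i l
    rcases Nat.mod_two_eq_zero_or_one (c / 64 ^ i) with h | h
    · rw [h, pow_zero, one_mul]; rfl
    · rw [h, pow_one, Nat.beq_refl, cond_true, termSum_cancel, termSum_mulTerms]
      simp [circ, add_assoc]
  rw [circLevel]
  simp only [List.foldr_cons, List.foldr_nil, key, Finset.prod_range_succ, Finset.prod_range_zero]
  simp
  ring

theorem termSum_circTerms (c t k : ℕ) : termSum K (circTerms c t k) =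
    ∏ i ∈ Finset.range 5, circ K i ^ (c / 64 ^ i / 2 ^ k % 2 ^ t) := by
  induction t generalizing k with
  | zero => simp [circTerms, Nat.mod_one]
  | succ t ih =>
    rw [circTerms, termSum_mulTerms, termSum_map_two_mul, ih, termSum_circLevel,
      ← Finset.prod_pow, ← Finset.prod_mul_distrib]
    refine Finset.prod_congr rfl fun i _ => ?_
    rw [← pow_mul, ← pow_add, Nat.div_right_comm, pow_succ' 2 t, Nat.mod_mul, pow_succ,
      ← Nat.div_div_eq_div_mul, mul_comm 2]

theorem bit_xor (j a b : ℕ) : bit K j (a ^^^ b) = bit K j a + bit K j b := by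
  simp only [bit, Nat.testBit_xor]
  rcases a.testBit j <;> rcases b.testBit j <;> simp [CharTwo.add_self_eq_zero]

theorem bit_xorSum (j : ℕ) (h : ℕ → ℕ) (l : List ℕ) :
    bit K j (xorSum h l) = (l.map fun c => bit K j (h c)).sum := by
  induction l with
  | nil => exact bit_zero j
  | cons c l ih => rw [xorSum_cons, bit_xor, ih, List.map_cons, List.sum_cons]

theorem bitFunctional_termSum (j : ℕ) (h : ℕ → ℕ) (l : List ℕ) :
    bitFunctional K j h (termSum K l) = bit K j (xorSum h l) := by
  rw [bit_xorSum]
  induction l with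
  | nil => simp
  | cons c l ih => rw [termSum_cons, map_add, bitFunctional_X_pow, ih, List.map_cons, List.sum_cons]

end CharTwo

end Semantics

section Expand

variable (K : Type*) [CommRing K]

/-- A binomial in a variable recording codes and a variable recording the excess. -/
def binomial (u v s : ℕ) : Polynomial (Polynomial K) :=
  Polynomial.C (Polynomial.X ^ u) + Polynomial.C (Polynomial.X ^ v) * Polynomial.X ^ s

namespace Binomials

/-- The product of a list of binomials. -/
def prod : Binomials → Polynomial (Polynomial K)
  | nil => 1
  | cons u v s B => binomial K u v s * B.prod

/-- The sum of the values of a function along a list of binomials. -/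
def sum (f : ℕ → ℕ → ℕ → ℕ) : Binomials → ℕ
  | nil => 0
  | cons u v s B => f u v s + B.sum f

/-- The code of the product of the first terms. -/
def base (B : Binomials) : ℕ := B.sum fun u _ _ => u

/-- The total excess. -/
def excess (B : Binomials) : ℕ := B.sum fun _ _ s => s

/-- The excesses are positive and the two terms of each binomial have the same weight. -/
def Valid : Binomials → Prop
  | nil => True
  | cons u v s B => (0 < s ∧ v % 31 = u % 31) ∧ B.Valid

theorem restrict_cons (c u v s : ℕ) (B : Binomials) : (cons u v s B).restrict c =
    cond (Nat.beq (Nat.land c u) u) (cons u v s (B.restrict c)) (B.restrict c) := rfl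

theorem Valid.restrict {B : Binomials} (h : B.Valid) (c : ℕ) : (B.restrict c).Valid := by
  induction B with
  | nil => trivial
  | cons u v s B ih =>
    rw [restrict_cons]
    cases Nat.beq (Nat.land c u) u
    · exact ih h.2
    · exact ⟨h.1, ih h.2⟩

theorem expand_nil (m r t : ℕ) (L : List ℕ) : nil.expand m r t L = if r = 0 then m :: L else L := by
  cases r <;> rfl

theorem expand_cons (u v s : ℕ) (B : Binomials) (m r t : ℕ) (L : List ℕ) :
    (cons u v s B).expand m r t L =
      if r = 0 then m :: L else if r ≤ t then
        if s ≤ r then B.expand m r (t - s) (B.expand (m + v - u) (r - s) (t - s) L)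
        else B.expand m r (t - s) L
      else L := by
  have h : (cons u v s B).expand m r t L =
      cond (Nat.beq r 0) (m :: L) (cond (Nat.ble r t)
        (withNat (Nat.sub t s) fun t =>
          cond (Nat.ble s r)
            (B.expand m r t (withNat (Nat.sub r s) fun r =>
              withNat (Nat.sub (Nat.add m v) u) fun m => B.expand m r t L))
            (B.expand m r t L))
        L) := rfl
  rw [h]
  simp only [withNat_eq]
  by_cases h1 : r = 0
  · subst h1; rfl
  · rw [if_neg h1, beq_eq_false h1, cond_false]
    by_cases h2 : r ≤ t
    · rw [if_pos h2, Nat.ble_eq.mpr h2, cond_true]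
      by_cases h3 : s ≤ r
      · rw [if_pos h3, Nat.ble_eq.mpr h3]; rfl
      · rw [if_neg h3, ble_eq_false h3]; rfl
    · rw [if_neg h2, ble_eq_false h2]; rfl

theorem mod_of_mem_expand {B : Binomials} (hB : B.Valid) {b m r t c : ℕ} {L : List ℕ}
    (hm : m = b + B.base) (hc : c ∈ B.expand m r t L) : c % 31 = m % 31 ∨ c ∈ L := by
  induction B generalizing b m r t L with
  | nil =>
    rw [expand_nil] at hc
    split_ifs at hc
    · rcases List.mem_cons.mp hc with h | h
      · exact Or.inl (h ▸ rfl)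
      · exact Or.inr h
    · exact Or.inr hc
  | cons u v s B ih =>
    have hbase : (cons u v s B).base = u + B.base := rfl
    rw [hbase] at hm
    rw [expand_cons] at hc
    have h0 := hB.1.2
    split_ifs at hc
    · rcases List.mem_cons.mp hc with h | h
      · exact Or.inl (h ▸ rfl)
      · exact Or.inr h
    · rcases ih (b := b + u) hB.2 (by omega) hc with h | h
      · exact Or.inl h
      · rcases ih (b := b + v) hB.2 (by omega) h with h | h
        · left; omega
        · exact Or.inr h
    · exact ih (b := b + u) hB.2 (by omega) hc
    · exact Or.inr hc

theorem natDegree_prod_le (B : Binomials) : (B.prod K).natDegree ≤ B.excess := by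
  induction B with
  | nil => simp [prod]
  | cons u v s B ih =>
    refine Polynomial.natDegree_mul_le.trans (Nat.add_le_add ?_ ih)
    rw [binomial]
    compute_degree

theorem coeff_zero_prod {B : Binomials} (hB : B.Valid) :
    (B.prod K).coeff 0 = Polynomial.X ^ B.base := by
  induction B with
  | nil => simp [prod, base, sum]
  | cons u v s B ih =>
    have hbase : (cons u v s B).base = u + B.base := rfl
    rw [prod, Polynomial.mul_coeff_zero, ih hB.2, hbase, pow_add, binomial, Polynomial.coeff_add,
      Polynomial.coeff_C_zero, Polynomial.coeff_C_mul_X_pow, if_neg hB.1.1.ne, add_zero]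

theorem termSum_expand {B : Binomials} (hB : B.Valid) {b m r t : ℕ} {L : List ℕ}
    (hm : m = b + B.base) (ht : t = B.excess) :
    termSum K (B.expand m r t L) = Polynomial.X ^ b * (B.prod K).coeff r + termSum K L := by
  induction B generalizing b m r t L with
  | nil =>
    have : m = b := hm
    rw [expand_nil, prod, Polynomial.coeff_one, this]
    split_ifs <;> simp
  | cons u v s B ih =>
    have hbase : (cons u v s B).base = u + B.base := rfl
    have hexc : (cons u v s B).excess = s + B.excess := rfl
    have hp := natDegree_prod_le K (cons u v s B)
    have hz := coeff_zero_prod K hB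
    rw [hbase] at hm hz
    rw [hexc] at ht hp
    have hcoeff : ((cons u v s B).prod K).coeff r = Polynomial.X ^ u * (B.prod K).coeff r +
        Polynomial.X ^ v * if s ≤ r then (B.prod K).coeff (r - s) else 0 := by
      rw [prod, binomial, add_mul, Polynomial.coeff_add, mul_assoc, Polynomial.coeff_C_mul,
        Polynomial.coeff_C_mul, Polynomial.coeff_X_pow_mul']
    rw [expand_cons]
    split_ifs with h1 h2 h3
    · rw [h1, hz, termSum_cons, hm, pow_add]
    · rw [ih (b := b + u) hB.2 (by omega) (by omega), ih (b := b + v) hB.2 (by omega) (by omega),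
        hcoeff, if_pos h3]
      ring
    · rw [ih (b := b + u) hB.2 (by omega) (by omega), hcoeff, if_neg h3]
      ring
    · rw [Polynomial.coeff_eq_zero_of_natDegree_lt (by omega), mul_zero, zero_add]

/-- The binomial for a bit of an exponent. -/
def consBit (k : ℕ) (i : Fin 5) (B : Binomials) : Binomials :=
  cons (64 ^ (i : ℕ) * 2 ^ k) (64 ^ ((i + 4 : Fin 5) : ℕ) * 2 * 2 ^ k) (2 ^ k) B

end Binomials

open Binomials

theorem allBinomials_eq : allBinomials = [4, 3, 2, 1, 0].foldr
    (fun k B => [0, 1, 2, 3, 4].foldr (consBit k) B) .nil := rfl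

theorem valid_allBinomials : allBinomials.Valid := by
  simp only [allBinomials, Valid]
  decide

theorem beq_land_encode {d : Fin 5 → ℕ} (hd : ∀ i, d i < 32) (i : Fin 5) {k : ℕ} (hk : k < 5) :
    Nat.beq (Nat.land (encode d) (64 ^ (i : ℕ) * 2 ^ k)) (64 ^ (i : ℕ) * 2 ^ k) =
      (d i).testBit k := by
  have h1 : 64 ^ (i : ℕ) * 2 ^ k = 2 ^ (6 * (i : ℕ) + k) := by
    rw [pow_add, pow_mul]; norm_num
  have h2 : (encode d).testBit (6 * (i : ℕ) + k) = (d i).testBit k := by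
    have h0 := hd 0
    have h1 := hd 1
    have h2 := hd 2
    have h3 := hd 3
    have h4 := hd 4
    rw [encode, code_eq, Nat.testBit_eq_decide_div_mod_eq, Nat.testBit_eq_decide_div_mod_eq]
    congr 2
    interval_cases k <;> fin_cases i <;> simp <;> omega
  have h3 : Nat.land (encode d) (2 ^ (6 * (i : ℕ) + k)) =
      (encode d) &&& (2 ^ (6 * (i : ℕ) + k)) := rfl
  rw [h1, h3, Nat.and_two_pow, h2]
  rcases (d i).testBit k
  · rw [Bool.toNat_false, zero_mul]
    exact beq_eq_false (Nat.two_pow_pos _).ne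
  · rw [Bool.toNat_true, one_mul, Nat.beq_refl]

variable {K}

theorem prod_restrict_consBit {d : Fin 5 → ℕ} (hd : ∀ i, d i < 32) (i : Fin 5) {k : ℕ} (hk : k < 5)
    (B : Binomials) : ((consBit k i B).restrict (encode d)).prod K = (if (d i).testBit k then
      binomial K (64 ^ (i : ℕ) * 2 ^ k) (64 ^ ((i + 4 : Fin 5) : ℕ) * 2 * 2 ^ k) (2 ^ k) else 1) *
        (B.restrict (encode d)).prod K := by
  rw [consBit, restrict_cons, beq_land_encode hd i hk]
  rcases (d i).testBit k <;> simp [Binomials.prod]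

theorem sum_restrict_consBit {d : Fin 5 → ℕ} (hd : ∀ i, d i < 32) (i : Fin 5) {k : ℕ} (hk : k < 5)
    (B : Binomials) (f : ℕ → ℕ → ℕ → ℕ) :
    ((consBit k i B).restrict (encode d)).sum f = (if (d i).testBit k then
      f (64 ^ (i : ℕ) * 2 ^ k) (64 ^ ((i + 4 : Fin 5) : ℕ) * 2 * 2 ^ k) (2 ^ k) else 0) +
        (B.restrict (encode d)).sum f := by
  rw [consBit, restrict_cons, beq_land_encode hd i hk]
  rcases (d i).testBit k <;> simp [Binomials.sum]

theorem sum_restrict_allBinomials {d : Fin 5 → ℕ} (hd : ∀ i, d i < 32) (a : Fin 5 → ℕ)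
    (f : ℕ → ℕ → ℕ → ℕ) (hf : ∀ (i : Fin 5) (k : ℕ),
      f (64 ^ (i : ℕ) * 2 ^ k) (64 ^ ((i + 4 : Fin 5) : ℕ) * 2 * 2 ^ k) (2 ^ k) = a i * 2 ^ k) :
    (allBinomials.restrict (encode d)).sum f = ∑ i, a i * d i := by
  have h1 : ∀ e < 32, e = (if e.testBit 0 then 1 else 0) + (if e.testBit 1 then 2 else 0) +
      (if e.testBit 2 then 4 else 0) + (if e.testBit 3 then 8 else 0) +
      (if e.testBit 4 then 16 else 0) := by decide
  have h2 : ∀ i, a i * d i = (if (d i).testBit 0 then a i else 0) +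
      (if (d i).testBit 1 then a i * 2 else 0) + (if (d i).testBit 2 then a i * 4 else 0) +
      (if (d i).testBit 3 then a i * 8 else 0) + (if (d i).testBit 4 then a i * 16 else 0) := by
    intro i
    conv_lhs => rw [h1 (d i) (hd i)]
    simp [mul_add]
  have h3 : (Binomials.nil.restrict (encode d)).sum f = 0 := rfl
  rw [allBinomials_eq]
  simp only [List.foldr_cons, List.foldr_nil]
  repeat rw [sum_restrict_consBit hd _ (by norm_num), hf]
  rw [h3]
  simp only [Fin.sum_univ_five, h2]
  norm_num
  ring

theorem base_restrict_allBinomials {d : Fin 5 → ℕ} (hd : ∀ i, d i < 32) :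
    (allBinomials.restrict (encode d)).base = encode d := by
  rw [base, sum_restrict_allBinomials hd (fun i => 64 ^ (i : ℕ)) _ fun i k => rfl, encode, code_eq]
  simp [Fin.sum_univ_five]

theorem excess_restrict_allBinomials {d : Fin 5 → ℕ} (hd : ∀ i, d i < 32) :
    (allBinomials.restrict (encode d)).excess = ∑ i, d i := by
  rw [excess, sum_restrict_allBinomials hd (fun _ => 1) _ fun i k => (one_mul _).symm]
  simp

theorem mod_of_mem_sqTerms {d : Fin 5 → ℕ} (hd : ∀ i, d i < 32) {r t c : ℕ}
    (hc : c ∈ sqTerms (encode d) r t) : c % 31 = encode d % 31 := by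
  rcases mod_of_mem_expand (b := 0) (valid_allBinomials.restrict _)
    (by rw [base_restrict_allBinomials hd, zero_add]) hc with h | h
  · exact h
  · exact absurd h List.not_mem_nil

/-- The twisted total Steenrod square. -/
def twistedSq (K : Type*) [CommRing K] : MvPolynomial (Fin 5) K →ₐ[K] MvPolynomial (Fin 5) K :=
  aeval fun i => X i + X (i + 4) ^ 2

theorem twistedSq_X (i : Fin 5) : twistedSq K (X i) = X i + X (i + 4) ^ 2 := by
  rw [twistedSq, aeval_X]

/-- The algebra map sending monomials to powers of a variable according to their codes. -/
def toPoly : MvPolynomial (Fin 5) K →ₐ[K] Polynomial K :=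
  aeval fun i => Polynomial.X ^ 64 ^ (i : ℕ)

theorem toPoly_X (i : Fin 5) : toPoly (X i : MvPolynomial (Fin 5) K) =
    Polynomial.X ^ 64 ^ (i : ℕ) := by
  rw [toPoly, aeval_X]

theorem monomial_eq_prod_univ (d : Fin 5 →₀ ℕ) :
    (monomial d 1 : MvPolynomial (Fin 5) K) = ∏ i, X i ^ d i := by
  rw [monomial_eq, C_1, one_mul, Finsupp.prod_fintype _ _ fun i => pow_zero _]

theorem toPoly_monomial (d : Fin 5 →₀ ℕ) :
    toPoly (monomial d 1 : MvPolynomial (Fin 5) K) = Polynomial.X ^ encode d := by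
  rw [monomial_eq_prod_univ, map_prod, encode, code_eq]
  simp_rw [map_pow, toPoly_X, ← pow_mul]
  rw [Finset.prod_pow_eq_pow_sum, Fin.sum_univ_five]
  simp

section CharTwo

variable [CharP K 2]

theorem binomial_pow (u v : ℕ) {e : ℕ} (he : e < 32) : binomial K u v 1 ^ e =
    (if e.testBit 0 then binomial K u v 1 else 1) *
    (if e.testBit 1 then binomial K (u * 2) (v * 2) 2 else 1) *
    (if e.testBit 2 then binomial K (u * 4) (v * 4) 4 else 1) *
    (if e.testBit 3 then binomial K (u * 8) (v * 8) 8 else 1) *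
    (if e.testBit 4 then binomial K (u * 16) (v * 16) 16 else 1) := by
  have h : ∀ s, binomial K (u * s) (v * s) s ^ 2 =
      binomial K (u * (s * 2)) (v * (s * 2)) (s * 2) := by
    intro s
    rw [binomial, CharTwo.add_sq, mul_pow, ← map_pow, ← map_pow, ← pow_mul, ← pow_mul, ← pow_mul,
      mul_assoc, mul_assoc, binomial]
  have h2 : binomial K (u * 2) (v * 2) 2 = binomial K u v 1 ^ 2 := by simpa using (h 1).symm
  have h4 : binomial K (u * 4) (v * 4) 4 = binomial K u v 1 ^ 4 := by
    rw [← h 2, h2, ← pow_mul]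
  have h8 : binomial K (u * 8) (v * 8) 8 = binomial K u v 1 ^ 8 := by
    rw [← h 4, h4, ← pow_mul]
  have h16 : binomial K (u * 16) (v * 16) 16 = binomial K u v 1 ^ 16 := by
    rw [← h 8, h8, ← pow_mul]
  rw [h2, h4, h8, h16]
  have h1 : ∀ e < 32, e = (if e.testBit 0 then 1 else 0) + (if e.testBit 1 then 2 else 0) +
      (if e.testBit 2 then 4 else 0) + (if e.testBit 3 then 8 else 0) +
      (if e.testBit 4 then 16 else 0) := by decide
  conv_lhs => rw [h1 e he]
  simp only [pow_add, pow_ite, pow_one, pow_zero]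

theorem prod_restrict_allBinomials {d : Fin 5 → ℕ} (hd : ∀ i, d i < 32) :
    (allBinomials.restrict (encode d)).prod K =
      ∏ i : Fin 5, binomial K (64 ^ (i : ℕ)) (64 ^ ((i + 4 : Fin 5) : ℕ) * 2) 1 ^ d i := by
  have h3 : (Binomials.nil.restrict (encode d)).prod K = 1 := rfl
  rw [allBinomials_eq]
  simp only [List.foldr_cons, List.foldr_nil]
  repeat rw [prod_restrict_consBit hd _ (by norm_num)]
  rw [h3]
  simp_rw [binomial_pow _ _ (hd _)]
  rw [Fin.prod_univ_five]
  simp only [pow_zero, mul_one, pow_one, Nat.reducePow]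
  ac_rfl

theorem toPoly_component_twistedSq (d : Fin 5 →₀ ℕ) (hd : ∀ i, d i < 32) (r : ℕ) :
    toPoly (homogeneousComponent (d.degree + r) (twistedSq K (monomial d 1))) =
      termSum K (sqTerms (encode d) r d.degree) := by
  have h1 : termSum K (sqTerms (encode d) r d.degree) =
      ((allBinomials.restrict (encode d)).prod K).coeff r := by
    rw [sqTerms, termSum_expand K (b := 0) (valid_allBinomials.restrict _)
      (by rw [base_restrict_allBinomials hd, zero_add])
      (by rw [excess_restrict_allBinomials hd, Finsupp.degree_eq_sum])]
    simp
  have h2 : ∀ i : Fin 5, Polynomial.map (toPoly (K := K)).toRingHom (toGraded (twistedSq K (X i))) =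
      Polynomial.X * binomial K (64 ^ (i : ℕ)) (64 ^ ((i + 4 : Fin 5) : ℕ) * 2) 1 := by
    intro i
    have h3 : ∀ j : Fin 5, (toPoly (K := K)).toRingHom (X j) = Polynomial.X ^ 64 ^ (j : ℕ) :=
      toPoly_X
    rw [twistedSq_X, map_add, map_pow, toGraded_X, toGraded_X]
    simp only [Polynomial.map_add, Polynomial.map_mul, Polynomial.map_pow, Polynomial.map_C,
      Polynomial.map_X, h3]
    rw [binomial, mul_pow, ← map_pow, ← pow_mul]
    ring
  have h3 : Polynomial.map (toPoly (K := K)).toRingHom (toGraded (twistedSq K (monomial d 1))) =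
      Polynomial.X ^ d.degree * (allBinomials.restrict (encode d)).prod K := by
    rw [monomial_eq_prod_univ, map_prod, map_prod, Polynomial.map_prod,
      prod_restrict_allBinomials hd, Finsupp.degree_eq_sum, ← Finset.prod_pow_eq_pow_sum,
      ← Finset.prod_mul_distrib]
    refine Finset.prod_congr rfl fun i _ => ?_
    rw [map_pow, map_pow, Polynomial.map_pow, h2, mul_pow]
  rw [h1, ← toGraded_coeff]
  have h4 := congrArg (fun p => Polynomial.coeff p (d.degree + r)) h3
  simp only [Polynomial.coeff_map] at h4
  rw [add_comm d.degree r, Polynomial.coeff_X_pow_mul, add_comm r] at h4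
  exact h4

end CharTwo

end Expand

section Soundness

variable {K : Type*} [CommRing K]

/-- The monomial with a given code. -/
def decode (K : Type*) [CommRing K] (c : ℕ) : MvPolynomial (Fin 5) K :=
  monomial (Finsupp.equivFunOnFinite.symm (digits c)) 1

theorem decode_encode {d : Fin 5 →₀ ℕ} (hd : ∀ i, d i < 64) :
    decode K (encode d) = monomial d 1 := by
  have h : Finsupp.equivFunOnFinite.symm (digits (encode d)) = d := by
    rw [digits_encode hd, Finsupp.equivFunOnFinite_symm_coe]
  rw [decode, h]

/-- The linear map from polynomials in one variable to polynomials in five variables sending powers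
of the variable to the monomials with this code. -/
def ofPoly : Polynomial K →ₗ[K] MvPolynomial (Fin 5) K :=
  (Polynomial.basisMonomials K).constr K (decode K)

theorem ofPoly_X_pow (c : ℕ) : ofPoly (Polynomial.X ^ c : Polynomial K) = decode K c := by
  have : (Polynomial.X ^ c : Polynomial K) = Polynomial.basisMonomials K c := by
    rw [Polynomial.coe_basisMonomials, Polynomial.X_pow_eq_monomial]
  rw [this, ofPoly, Module.Basis.constr_basis]

theorem ofPoly_termSum (l : List ℕ) : ofPoly (termSum K l) = (l.map (decode K)).sum := by
  induction l with
  | nil => simp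
  | cons c l ih => rw [termSum_cons, map_add, ofPoly_X_pow, ih, List.map_cons, List.sum_cons]

theorem monomial_eq_smul (d : Fin 5 →₀ ℕ) (a : K) :
    (monomial d a : MvPolynomial (Fin 5) K) = a • monomial d 1 := by
  rw [smul_monomial, smul_eq_mul, mul_one]

theorem degree_eq_of_mem_support {n : ℕ} {p : MvPolynomial (Fin 5) K} (hp : p.IsHomogeneous n)
    {d : Fin 5 →₀ ℕ} (hd : d ∈ p.support) : d.degree = n := by
  by_contra h
  exact (mem_support_iff.mp hd) (hp.coeff_eq_zero h)

theorem ofPoly_toPoly {n : ℕ} (hn : n < 64) {p : MvPolynomial (Fin 5) K} (hp : p.IsHomogeneous n) :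
    ofPoly (toPoly p) = p := by
  conv_rhs => rw [p.as_sum]
  conv_lhs => rw [p.as_sum, map_sum, map_sum]
  refine Finset.sum_congr rfl fun d hd => ?_
  have h := degree_eq_of_mem_support hp hd
  rw [monomial_eq_smul, map_smul, map_smul, toPoly_monomial, ofPoly_X_pow, decode_encode]
  intro i
  have := Finsupp.le_degree i d
  omega

theorem twistedSq_sub_mem_pow (n : ℕ) (p : MvPolynomial (Fin 5) K)
    (hp : p ∈ idealOfVars (Fin 5) K ^ n) : twistedSq K p - p ∈ idealOfVars (Fin 5) K ^ (n + 1) :=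
  algHom_sub_mem_pow _ (fun i => by
    rw [twistedSq_X, add_sub_cancel_left]; exact X_pow_mem _ 2) n p hp

theorem component_twistedSq_sub {n : ℕ} {d : Fin 5 →₀ ℕ} (hd : d.degree < n) :
    homogeneousComponent n (twistedSq K (monomial d 1) - monomial d 1) =
      homogeneousComponent n (twistedSq K (monomial d 1)) := by
  rw [map_sub, homogeneousComponent_of_mem (isHomogeneous_monomial 1 rfl), if_neg hd.ne', sub_zero]

theorem dualValue_eq_zero (t : SearchTree) {c : ℕ} (h0 : c % 31 ≠ 0) (h15 : c % 31 ≠ 15) :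
    dualValue t c = 0 := by
  have h0' : Nat.beq (Nat.mod c 31) 0 = false := beq_eq_false h0
  have h15' : Nat.beq (Nat.mod c 31) 15 = false := beq_eq_false h15
  rw [dualValue]
  simp only [withNat_eq, h0', h15', cond_false]

theorem xorSum_eq_zero {h : ℕ → ℕ} {l : List ℕ} (hl : ∀ c ∈ l, h c = 0) : xorSum h l = 0 := by
  induction l with
  | nil => rfl
  | cons c l ih =>
    rw [xorSum_cons, hl c List.mem_cons_self, ih fun x hx => hl x (List.mem_cons_of_mem _ hx)]
    rfl

theorem dualCheckAt_imp {n : ℕ} {t : SearchTree} {a b c d e x : ℕ}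
    (h : dualCheckAt n t a b c d e x = true) (hx : x < a) :
    xorSum (dualValue t) (sqTerms (code x b c d e) (a - x) (n - (a - x))) = 0 := by
  have h1 : Nat.blt x a = true := Nat.ble_eq.mpr hx
  rw [dualCheckAt, h1, cond_true, withNat_eq, withNat_eq] at h
  exact Nat.eq_of_beq_eq_true h

theorem xorSum_sqTerms_eq_zero {n : ℕ} (hn : n ≤ 31) {t : SearchTree} (h : dualCheck n t = true)
    {d : Fin 5 →₀ ℕ} (hd : d.degree < n) :
    xorSum (dualValue t) (sqTerms (encode d) (n - d.degree) d.degree) = 0 := by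
  have hdeg : d.degree = d 0 + d 1 + d 2 + d 3 + d 4 := by
    rw [Finsupp.degree_eq_sum, Fin.sum_univ_five]
  have hlt : ∀ i, d i < 32 := fun i => by have := Finsupp.le_degree i d; omega
  set a := n - (d 1 + d 2 + d 3 + d 4) with ha
  have h1 := allExponents_imp h (a := a) (b := d 1) (c := d 2) (d := d 3) (e := d 4) (by omega)
  simp only [withNat_eq, cond_eq_true_iff] at h1
  have h2 : n - (a - d 0) = d.degree := by omega
  have h3 : a - d 0 = n - d.degree := by omega
  have h4 : encode d % 31 = (d 0 + code 0 (d 1) (d 2) (d 3) (d 4) % 31) % 31 := by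
    rw [encode, code_eq, code_eq]; omega
  have h5 : ∀ x, dualCheckAt n t a (d 1) (d 2) (d 3) (d 4) x = true → x = d 0 →
      xorSum (dualValue t) (sqTerms (encode d) (n - d.degree) d.degree) = 0 := by
    rintro x hx rfl
    have := dualCheckAt_imp hx (by omega)
    rwa [h2, h3] at this
  by_cases h0 : encode d % 31 = 0
  · refine h5 _ h1.1 ?_
    change (31 - (code 0 (d 1) (d 2) (d 3) (d 4) % 31)) % 31 = d 0
    have := Nat.mod_lt (code 0 (d 1) (d 2) (d 3) (d 4)) (show 0 < 31 by norm_num)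
    omega
  · by_cases h15 : encode d % 31 = 15
    · refine h5 _ h1.2 ?_
      change (46 - (code 0 (d 1) (d 2) (d 3) (d 4) % 31)) % 31 = d 0
      have := Nat.mod_lt (code 0 (d 1) (d 2) (d 3) (d 4)) (show 0 < 31 by norm_num)
      omega
    · refine xorSum_eq_zero fun c hc => ?_
      have := mod_of_mem_sqTerms hlt hc
      exact dualValue_eq_zero t (by omega) (by omega)

/-- The substitution adding to each variable the next two variables in cyclic order. -/
def circSubst (K : Type*) [CommRing K] : MvPolynomial (Fin 5) K →ₐ[K] MvPolynomial (Fin 5) K :=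
  aeval fun i => X i + X (i + 1) + X (i + 2)

theorem circSubst_X (i : Fin 5) : circSubst K (X i) = X i + X (i + 1) + X (i + 2) := by
  rw [circSubst, aeval_X]

theorem digits_apply {m : ℕ} (hm : m < 1073741824) (i : Fin 5) :
    digits m i = m / 64 ^ (i : ℕ) % 64 := by
  fin_cases i
  · exact (congrArg (· % 64) (Nat.div_one m)).symm
  · rfl
  · rfl
  · rfl
  · change m / 16777216 = m / 16777216 % 64
    omega

theorem toPoly_circSubst_X (i : Fin 5) : toPoly (circSubst K (X i)) = circ K i := by
  rw [circSubst_X, map_add, map_add, toPoly_X, toPoly_X, toPoly_X, Fin.val_add, Fin.val_add]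
  rfl

theorem toPoly_circSubst_decode {m : ℕ} (hm : m < 1073741824) :
    toPoly (circSubst K (decode K m)) = ∏ i ∈ Finset.range 5, circ K i ^ (m / 64 ^ i % 64) := by
  rw [decode, monomial_eq_prod_univ, map_prod, map_prod, Finset.prod_range]
  refine Finset.prod_congr rfl fun i _ => ?_
  rw [map_pow, map_pow, toPoly_circSubst_X, Finsupp.coe_equivFunOnFinite_symm, digits_apply hm]

theorem xorSum_append (h : ℕ → ℕ) (l m : List ℕ) :
    xorSum h (l ++ m) = xorSum h l ^^^ xorSum h m := by
  induction l with
  | nil => exact (Nat.zero_xor _).symm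
  | cons c l ih => rw [List.cons_append, xorSum_cons, ih, xorSum_cons, Nat.xor_assoc]

theorem xorSum_mulTerms (h : ℕ → ℕ) (l m : List ℕ) : xorSum h (mulTerms l m) =
    xorSum (fun x => xorSum (fun y => h (Nat.add x y)) m) l := by
  have key : ∀ (f : ℕ → ℕ) (m : List ℕ), xorSum h (m.map f) = xorSum (fun y => h (f y)) m := by
    intro f m
    induction m with
    | nil => rfl
    | cons c m ih => rw [List.map_cons, xorSum_cons, ih, xorSum_cons]
  induction l with
  | nil => rfl
  | cons c l ih =>
    rw [mulTerms, List.flatMap_cons, xorSum_append, key, ← mulTerms, ih, xorSum_cons]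

theorem bit_two_pow (j k : ℕ) : bit K j (2 ^ k) = if j = k then 1 else 0 := by
  simp [bit, Nat.testBit_two_pow, eq_comm]

namespace Cert

variable {D : Cert}

theorem mon_lt (i : ℕ) : D.mon i < 1073741824 := Nat.mod_lt _ (by norm_num)

theorem indexed_iff (c : ℕ) :
    D.indexed c = true ↔ D.index.find c < D.size ∧ D.mon (D.index.find c) = c := by
  rw [indexed, withNat_eq, cond_eq_true_iff]
  refine and_congr (iff_of_eq Nat.ble_eq) ⟨Nat.eq_of_beq_eq_true, fun h => ?_⟩
  rw [h]
  exact Nat.beq_refl c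

variable (K D) in
/-- The sum of the monomials whose indices are the bits of a number. -/
def bitSum (v : ℕ) : MvPolynomial (Fin 5) K :=
  ∑ i ∈ Finset.range D.size, bit K i v • decode K (D.mon i)

theorem bitSum_two_pow {c : ℕ} (hc : D.indexed c = true) :
    D.bitSum K (2 ^ D.index.find c) = decode K c := by
  rw [indexed_iff] at hc
  simp_rw [bitSum, bit_two_pow, ite_smul, one_smul, zero_smul]
  rw [Finset.sum_ite_eq', if_pos (Finset.mem_range.mpr hc.1), hc.2]

end Cert

variable [CharP K 2]

theorem component_twistedSq_eq_sum {n : ℕ} (hn : n ≤ 32) {d : Fin 5 →₀ ℕ} (hd : d.degree < n) :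
    homogeneousComponent n (twistedSq K (monomial d 1)) =
      ((sqTerms (encode d) (n - d.degree) d.degree).map (decode K)).sum := by
  have hlt : ∀ i, d i < 32 := fun i => by have := Finsupp.le_degree i d; omega
  rw [← ofPoly_toPoly (n := n) (by omega) (homogeneousComponent_isHomogeneous n _),
    ← ofPoly_termSum, ← toPoly_component_twistedSq d hlt, Nat.add_sub_cancel' hd.le]

theorem bitFunctional_toPoly_of_mem_hits {n : ℕ} (hn : n ≤ 31) {t : SearchTree}
    (h : dualCheck n t = true) (j : ℕ) {p : MvPolynomial (Fin 5) K}
    (hp : p ∈ hits (twistedSq K) n) : bitFunctional K j (dualValue t) (toPoly p) = 0 := by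
  obtain ⟨g, rfl⟩ := hp
  induction g using MvPolynomial.induction_on' with
  | add p q hp hq => rw [map_add, map_add, map_add, hp, hq, add_zero]
  | monomial d a =>
    rw [monomial_eq_smul, map_smul, map_smul, map_smul]
    simp only [LinearMap.comp_apply, LinearMap.sub_apply, LinearMap.id_apply,
      AlgHom.toLinearMap_apply]
    by_cases hd : d.degree < n
    · have hlt : ∀ i, d i < 32 := fun i => by have := Finsupp.le_degree i d; omega
      have h1 := toPoly_component_twistedSq (K := K) d hlt (n - d.degree)
      rw [Nat.add_sub_cancel' hd.le] at h1
      rw [component_twistedSq_sub hd, h1, bitFunctional_termSum, xorSum_sqTerms_eq_zero hn h hd,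
        bit_zero, smul_zero]
    · have hm : (monomial d 1 : MvPolynomial (Fin 5) K).IsHomogeneous d.degree :=
        isHomogeneous_monomial 1 rfl
      rw [homogeneousComponent_eq_zero_of_mem_pow (show n < d.degree + 1 by omega)
        (twistedSq_sub_mem_pow _ _ (mem_pow_of_isHomogeneous hm)), map_zero, map_zero, smul_zero]

namespace Cert

variable {D : Cert}

theorem bitFunctional_circSubst_sub (h : D.checkRank = true) (j : ℕ) {k : ℕ} (hk : k < D.rank) :
    bitFunctional K j (dualValue D.dual)
      (toPoly (circSubst K (decode K (D.mon k)) - decode K (D.mon k))) =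
        if j = k then 1 else 0 := by
  have hlt : Nat.blt k D.rank = true := Nat.ble_eq.mpr hk
  have h1 := (allLE_iff _ _).mp h k hk.le
  simp only [hlt, cond_true, withNat_eq, withList_eq] at h1
  rw [← xorSum_mulTerms] at h1
  have h2 : xorSum (dualValue D.dual) (mulTerms (circLevel (D.mon k))
      ((circTerms (D.mon k) 5 1).map fun x => 2 * x)) ^^^ dualValue D.dual (D.mon k) = 2 ^ k :=
    Nat.eq_of_beq_eq_true h1
  have h3 : toPoly (circSubst K (decode K (D.mon k))) = termSum K (mulTerms (circLevel (D.mon k))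
      ((circTerms (D.mon k) 5 1).map fun x => 2 * x)) := by
    rw [toPoly_circSubst_decode (mon_lt k), termSum_mulTerms, termSum_map_two_mul,
      termSum_circLevel, termSum_circTerms, ← Finset.prod_pow, ← Finset.prod_mul_distrib]
    refine Finset.prod_congr rfl fun i _ => ?_
    rw [← pow_mul, ← pow_add]
    congr 1
    omega
  have h4 : toPoly (decode K (D.mon k)) = Polynomial.X ^ D.mon k := by
    rw [decode, toPoly_monomial, Finsupp.coe_equivFunOnFinite_symm, encode_digits]
  rw [map_sub, map_sub, h3, h4, bitFunctional_termSum, bitFunctional_X_pow, CharTwo.sub_eq_add,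
    ← bit_xor, h2, bit_two_pow]

theorem bitSum_xor (v w : ℕ) : D.bitSum K (v ^^^ w) = D.bitSum K v + D.bitSum K w := by
  simp_rw [bitSum, bit_xor, add_smul, Finset.sum_add_distrib]

theorem bitSum_xorSum (h : ℕ → ℕ) (l : List ℕ) :
    D.bitSum K (xorSum h l) = (l.map fun c => D.bitSum K (h c)).sum := by
  induction l with
  | nil => simp [xorSum, bitSum, bit_zero]
  | cons c l ih => rw [xorSum_cons, bitSum_xor, ih, List.map_cons, List.sum_cons]

theorem bitSum_hitRow_mem_hits (hn : D.deg ≤ 31) {m : ℕ} (hm : D.checkHit m = true) :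
    D.bitSum K (D.hitRow m) ∈ hits (twistedSq K) D.deg := by
  rw [checkHit, withNat_eq, cond_eq_true_iff, withNat_eq, List.all_eq_true] at hm
  obtain ⟨h1, h2⟩ := hm
  set d : Fin 5 →₀ ℕ := Finsupp.equivFunOnFinite.symm (digits m) with hd
  have hdeg : codeDeg m = d.degree := by rw [codeDeg_eq, Finsupp.degree_eq_sum]; rfl
  have henc : encode d = m := encode_digits m
  have h3 : d.degree < D.deg := hdeg ▸ Nat.ble_eq.mp h1
  have h4 : D.bitSum K (D.hitRow m) =
      homogeneousComponent D.deg (twistedSq K (monomial d 1) - monomial d 1) := by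
    rw [component_twistedSq_sub h3, component_twistedSq_eq_sum (by omega) h3, hitRow, withNat_eq,
      withNat_eq, bitSum_xorSum, hdeg, henc]
    refine congrArg List.sum (List.map_congr_left fun c hc => ?_)
    rw [← hdeg] at hc
    exact bitSum_two_pow (h2 c hc)
  rw [h4]
  exact component_mem_hits _ _ _

theorem exists_row {k : ℕ} {l : List (List ℕ)} (h : D.checkRows k l = true) {i : ℕ} (hk : k ≤ i)
    (hi : i < D.size) :
    ∃ r : List ℕ, (∀ m ∈ r, D.checkHit m = true) ∧ Nat.log2 (xorSum D.hitRow r) = i := by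
  induction l generalizing k with
  | nil =>
    have := Nat.eq_of_beq_eq_true h
    omega
  | cons r l ih =>
    rw [checkRows, cond_eq_true_iff, cond_eq_true_iff, withNat_eq, List.all_eq_true] at h
    rcases hk.eq_or_lt with rfl | hk
    · exact ⟨r, h.1, Nat.eq_of_beq_eq_true h.2.1⟩
    · exact ih h.2.2 hk

variable (K D) in
/-- The span of the first monomials and the hit polynomials. -/
def spanned : Submodule K (MvPolynomial (Fin 5) K) :=
  Submodule.span K (Set.range fun j : Fin D.rank => decode K (D.mon j)) ⊔
    hits (twistedSq K) D.deg

theorem decode_mon_mem (hn : D.deg ≤ 31) (hr : 0 < D.rank)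
    (h : D.checkRows D.rank D.rows = true) (i : ℕ) (hi : i < D.size) :
    decode K (D.mon i) ∈ D.spanned K := by
  induction i using Nat.strong_induction_on with
  | _ i ih =>
    by_cases hir : i < D.rank
    · exact Submodule.mem_sup_left (Submodule.subset_span ⟨⟨i, hir⟩, rfl⟩)
    · obtain ⟨r, hr1, hr2⟩ := exists_row h (not_lt.mp hir) hi
      set v := xorSum D.hitRow r with hv
      have hv0 : v ≠ 0 := by
        rintro h0
        rw [h0] at hr2
        have : Nat.log2 0 = 0 := by simp
        omega
      have h1 : D.bitSum K v ∈ D.spanned K := by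
        rw [hv, bitSum_xorSum]
        refine Submodule.mem_sup_right (list_sum_mem fun p hp => ?_)
        obtain ⟨m, hm, rfl⟩ := List.mem_map.mp hp
        exact bitSum_hitRow_mem_hits hn (hr1 m hm)
      have h2 : bit K i v = 1 := by
        rw [bit, if_pos]
        rw [← hr2]
        exact Nat.testBit_log2 hv0
      have h3 : ∀ k, i < k → bit K k v = 0 := by
        intro k hk
        rw [bit, if_neg]
        rw [Bool.not_eq_true]
        refine Nat.testBit_lt_two_pow ?_
        exact (Nat.log2_lt hv0).mp (hr2 ▸ hk)
      rw [bitSum, ← Finset.sum_erase_add _ _ (Finset.mem_range.mpr hi), h2, one_smul] at h1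
      refine (Submodule.add_mem_iff_right _ (Submodule.sum_mem _ fun k hk => ?_)).mp h1
      obtain ⟨hk1, hk2⟩ := Finset.mem_erase.mp hk
      rcases lt_or_gt_of_ne hk1 with hk3 | hk3
      · exact Submodule.smul_mem _ _ (ih k hk3 (Finset.mem_range.mp hk2))
      · rw [h3 k hk3, zero_smul]; exact Submodule.zero_mem _

theorem mem_spanned (hn : D.deg ≤ 31) (hr : 0 < D.rank) (hrows : D.checkRows D.rank D.rows = true)
    (hcomplete : D.checkComplete = true) {p : MvPolynomial (Fin 5) K} (hp : p.IsHomogeneous D.deg)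
    (hw : ∀ d ∈ p.support, encode d % 31 = 0) : p ∈ D.spanned K := by
  rw [p.as_sum]
  refine Submodule.sum_mem _ fun d hd => ?_
  have h := degree_eq_of_mem_support hp hd
  have hlt : ∀ i, d i < 64 := fun i => by have := Finsupp.le_degree i d; omega
  have h1 := allExponents_imp hcomplete (a := d 0) (b := d 1) (c := d 2) (d := d 3) (e := d 4)
    (by rw [← h, Finsupp.degree_eq_sum, Fin.sum_univ_five])
  have h2 : Nat.beq (Nat.mod (encode d) 31) 0 = true := by
    rw [show Nat.mod (encode d) 31 = 0 from hw d hd]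
    rfl
  simp only [withNat_eq] at h1
  rw [← encode, h2, cond_true, indexed_iff] at h1
  rw [monomial_eq_smul, ← decode_encode hlt, ← h1.2]
  exact Submodule.smul_mem _ _ (decode_mon_mem hn hr hrows _ h1.1)

theorem mem_hits (hn : D.deg ≤ 31) (hr : 0 < D.rank) (hrows : D.checkRows D.rank D.rows = true)
    (hcomplete : D.checkComplete = true) (hdual : D.checkDual = true) (hrank : D.checkRank = true)
    {p : MvPolynomial (Fin 5) K} (hp : p.IsHomogeneous D.deg)
    (hw : ∀ d ∈ p.support, encode d % 31 = 0)
    (hhits : ∀ q ∈ hits (twistedSq K) D.deg, circSubst K q ∈ hits (twistedSq K) D.deg)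
    (hcirc : circSubst K p - p ∈ hits (twistedSq K) D.deg) : p ∈ hits (twistedSq K) D.deg := by
  obtain ⟨q, hq, r, hr', rfl⟩ :=
    Submodule.mem_sup.mp (mem_spanned (K := K) hn hr hrows hcomplete hp hw)
  obtain ⟨c, rfl⟩ := (Submodule.mem_span_range_iff_exists_fun K).mp hq
  refine Submodule.add_mem _ ?_ hr'
  have h1 : circSubst K (∑ i, c i • decode K (D.mon i)) - ∑ i, c i • decode K (D.mon i) ∈
      hits (twistedSq K) D.deg := by
    have := Submodule.sub_mem _ hcirc (Submodule.sub_mem _ (hhits r hr') hr')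
    rwa [map_add, add_sub_add_comm, add_sub_cancel_right] at this
  have h2 : dualCheck D.deg D.dual = true := by
    rwa [checkDual, withNat_eq] at hdual
  have h3 : ∀ j, c j = 0 := by
    intro j
    have h4 := bitFunctional_toPoly_of_mem_hits hn h2 j h1
    rw [map_sum, ← Finset.sum_sub_distrib] at h4
    simp_rw [map_smul, ← smul_sub, map_sum, map_smul,
      bitFunctional_circSubst_sub hrank _ (Fin.is_lt _)] at h4
    simpa [Fin.val_inj] using h4
  simp [h3]

end Cert

end Soundness

section BaseCases

open scoped Matrix

/-- The matrix of a multiplication in the field with `32` elements with respect to a self-dual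
normal basis. -/
def mulMatrix : Matrix.GeneralLinearGroup (Fin 5) (ZMod 2) where
  val := !![0, 1, 0, 0, 0; 1, 0, 0, 1, 0; 0, 0, 0, 1, 1; 0, 1, 1, 0, 0; 0, 0, 1, 0, 1]
  inv := !![1, 1, 1, 1, 1; 1, 0, 0, 0, 0; 1, 0, 0, 1, 0; 1, 0, 1, 1, 1; 1, 0, 0, 1, 1]
  val_inv := by decide +kernel
  inv_val := by decide +kernel

/-- The circulant matrix of a multiplication by an element of the group ring of the cyclic group
with five elements. -/
def circMatrix : Matrix.GeneralLinearGroup (Fin 5) (ZMod 2) where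
  val := !![1, 0, 0, 1, 1; 1, 1, 0, 0, 1; 1, 1, 1, 0, 0; 0, 1, 1, 1, 0; 0, 0, 1, 1, 1]
  inv := !![0, 1, 0, 1, 1; 1, 0, 1, 0, 1; 1, 1, 0, 1, 0; 0, 1, 1, 0, 1; 1, 0, 1, 1, 0]
  val_inv := by decide +kernel
  inv_val := by decide +kernel

theorem exists_root (K : Type*) [Field K] [IsAlgClosed K] [CharP K 2] :
    ∃ β : K, β ^ 5 = β ^ 4 + β ^ 2 + β + 1 := by
  obtain ⟨β, hβ⟩ := IsAlgClosed.exists_root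
    (Polynomial.X ^ 5 + Polynomial.X ^ 4 + Polynomial.X ^ 2 + Polynomial.X + 1 : Polynomial K)
    (by
      have : (Polynomial.X ^ 5 + Polynomial.X ^ 4 + Polynomial.X ^ 2 + Polynomial.X + 1 :
        Polynomial K).degree = 5 := by compute_degree!
      rw [this]
      norm_num)
  refine ⟨β, ?_⟩
  simp only [Polynomial.IsRoot.def, Polynomial.eval_add, Polynomial.eval_pow, Polynomial.eval_X,
    Polynomial.eval_one] at hβ
  grind

variable {K : Type*} [Field K]

/-- The Steenrod square over an extension field. -/
def sqOver (K : Type*) [Field K] : MvPolynomial (Fin 5) K →ₐ[K] MvPolynomial (Fin 5) K :=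
  aeval fun i => X i + X i ^ 2

theorem sqOver_X (i : Fin 5) : sqOver K (X i) = X i + X i ^ 2 := by rw [sqOver, aeval_X]

/-- The iterated squares of an element. -/
def conjugate (β : K) (i : Fin 5) : K := β ^ 2 ^ (i : ℕ)

/-- The inverse of the change of coordinates diagonalizing the multiplication matrix. -/
def retract (β : K) : MvPolynomial (Fin 5) K →ₐ[K] MvPolynomial (Fin 5) K :=
  aeval fun i => ∑ j, conjugate β (i + j) • X j

theorem retract_X (β : K) (i : Fin 5) : retract β (X i) = ∑ j, conjugate β (i + j) • X j := by
  rw [retract, aeval_X]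

/-- The substitution multiplying the variables by the conjugates of an element. -/
def diagSubst (β : K) : MvPolynomial (Fin 5) K →ₐ[K] MvPolynomial (Fin 5) K :=
  aeval fun i => conjugate β i • X i

theorem diagSubst_X (β : K) (i : Fin 5) : diagSubst β (X i) = conjugate β i • X i := by
  rw [diagSubst, aeval_X]

theorem isHomogeneous_smul_X {ι : Type*} (s : Finset ι) (c : ι → K) (v : ι → Fin 5) :
    (∑ i ∈ s, c i • X (v i) : MvPolynomial (Fin 5) K).IsHomogeneous 1 :=
  IsHomogeneous.sum _ _ _ fun i _ =>
    (homogeneousSubmodule (Fin 5) K 1).smul_mem _ (isHomogeneous_X _ (v i))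

theorem iterate_sub_mem_hits {S φ : MvPolynomial (Fin 5) K →ₐ[K] MvPolynomial (Fin 5) K} {n : ℕ}
    (hφ : ∀ p ∈ hits S n, φ p ∈ hits S n) {p : MvPolynomial (Fin 5) K}
    (hp : φ p - p ∈ hits S n) (k : ℕ) :
    φ^[k] p - p ∈ hits S n := by
  induction k with
  | zero => simp
  | succ k ih =>
    rw [Function.iterate_succ_apply', ← sub_add_sub_cancel _ (φ p), ← map_sub]
    exact Submodule.add_mem _ (hφ _ ih) hp

theorem coeff_diagSubst (d : Fin 5 →₀ ℕ) (β : K) (p : MvPolynomial (Fin 5) K) :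
    coeff d (diagSubst β p) = β ^ (∑ i : Fin 5, 2 ^ (i : ℕ) * d i) * coeff d p := by
  induction p using MvPolynomial.induction_on' with
  | add p q hp hq => rw [map_add, coeff_add, hp, hq, coeff_add, mul_add]
  | monomial e a =>
    have h : diagSubst β (monomial e 1) = β ^ (∑ i : Fin 5, 2 ^ (i : ℕ) * e i) • monomial e 1 := by
      rw [monomial_eq_prod_univ, map_prod]
      simp_rw [map_pow, diagSubst_X, smul_pow, conjugate, ← pow_mul]
      rw [Finset.prod_smul, Finset.prod_pow_eq_pow_sum]
    rw [monomial_eq_smul, map_smul, h, coeff_smul, coeff_smul, coeff_smul, coeff_monomial]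
    split_ifs with hd
    · rw [hd]; simp [mul_comm]
    · simp

theorem encode_mod (d : Fin 5 → ℕ) : encode d % 31 = (∑ i : Fin 5, 2 ^ (i : ℕ) * d i) % 31 := by
  rw [encode, code_eq, Fin.sum_univ_five]
  change _ = (1 * d 0 + 2 * d 1 + 4 * d 2 + 8 * d 3 + 16 * d 4) % 31
  omega

section Root

variable [CharP K 2] {β : K}

theorem sq_conjugate (h : β ^ 5 = β ^ 4 + β ^ 2 + β + 1) (i : Fin 5) :
    conjugate β i ^ 2 = conjugate β (i + 1) := by
  have h32 : β ^ 32 = β := by grind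
  rw [conjugate, conjugate, ← pow_mul, ← pow_succ]
  fin_cases i
  iterate 4 rfl
  exact h32.trans (pow_one β).symm

theorem pow_thirtyOne (h : β ^ 5 = β ^ 4 + β ^ 2 + β + 1) : β ^ 31 = 1 := by grind

theorem ne_one_of_root (h : β ^ 5 = β ^ 4 + β ^ 2 + β + 1) : β ≠ 1 := by grind

theorem sum_conjugate (h : β ^ 5 = β ^ 4 + β ^ 2 + β + 1) :
    ∑ i, conjugate β i = 1 := by
  rw [Fin.sum_univ_five]
  change β ^ 1 + β ^ 2 + β ^ 4 + β ^ 8 + β ^ 16 = 1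
  grind

theorem retract_twistedSq (h : β ^ 5 = β ^ 4 + β ^ 2 + β + 1) (p : MvPolynomial (Fin 5) K) :
    retract β (twistedSq K p) = sqOver K (retract β p) := by
  refine DFunLike.congr_fun (f := (retract β).comp (twistedSq K))
    (g := (sqOver K).comp (retract β)) (algHom_ext fun i => ?_) p
  rw [AlgHom.comp_apply, AlgHom.comp_apply, twistedSq_X, map_add, map_pow, retract_X, retract_X,
    map_sum, CharTwo.sum_sq]
  simp_rw [map_smul, sqOver_X, smul_add, Finset.sum_add_distrib, smul_pow, sq_conjugate h]
  congr 1
  refine Finset.sum_congr rfl fun j _ => ?_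
  rw [add_right_comm, add_assoc i 4 1, show (4 + 1 : Fin 5) = 0 from rfl, add_zero]

theorem diagSubst_twistedSq (h : β ^ 5 = β ^ 4 + β ^ 2 + β + 1) (p : MvPolynomial (Fin 5) K) :
    diagSubst β (twistedSq K p) = twistedSq K (diagSubst β p) := by
  refine DFunLike.congr_fun (f := (diagSubst β).comp (twistedSq K))
    (g := (twistedSq K).comp (diagSubst β)) (algHom_ext fun i => ?_) p
  rw [AlgHom.comp_apply, AlgHom.comp_apply, twistedSq_X, map_add, map_pow, diagSubst_X,
    diagSubst_X, map_smul, twistedSq_X, smul_pow, sq_conjugate h, smul_add, add_assoc i 4 1,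
    show (4 + 1 : Fin 5) = 0 from rfl, add_zero]

theorem geom_sum_root (h : β ^ 5 = β ^ 4 + β ^ 2 + β + 1) (w : ℕ) :
    ∑ k ∈ Finset.range 31, (β ^ w) ^ k = if w % 31 = 0 then 1 else 0 := by
  have h31 := pow_thirtyOne h
  have ho : orderOf β = 31 :=
    haveI : Fact (Nat.Prime 31) := ⟨by norm_num⟩
    orderOf_eq_prime h31 (ne_one_of_root h)
  have hw : β ^ w = 1 ↔ w % 31 = 0 := by
    rw [← orderOf_dvd_iff_pow_eq_one, ho, Nat.dvd_iff_mod_eq_zero]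
  split_ifs with h0
  · have h2 : (2 : K) = 0 := CharTwo.two_eq_zero
    rw [hw.mpr h0]
    simp only [one_pow, Finset.sum_const, Finset.card_range, nsmul_eq_mul, mul_one]
    norm_num
    linear_combination 15 * h2
  · have h1 : β ^ w - 1 ≠ 0 := sub_ne_zero.mpr fun h' => h0 (hw.mp h')
    have := mul_geom_sum (β ^ w) 31
    rw [← pow_mul, mul_comm w, pow_mul, h31, one_pow, sub_self] at this
    exact (mul_eq_zero.mp this).resolve_left h1

theorem circSubst_twistedSq (p : MvPolynomial (Fin 5) K) :
    circSubst K (twistedSq K p) = twistedSq K (circSubst K p) := by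
  refine DFunLike.congr_fun (f := (circSubst K).comp (twistedSq K))
    (g := (twistedSq K).comp (circSubst K)) (algHom_ext fun i => ?_) p
  rw [AlgHom.comp_apply, AlgHom.comp_apply, twistedSq_X, map_add, map_pow, circSubst_X,
    circSubst_X, map_add, map_add, twistedSq_X, twistedSq_X, twistedSq_X, CharTwo.add_sq,
    CharTwo.add_sq, add_right_comm i 4 1, add_right_comm i 4 2]
  ring

end Root

variable [Algebra (ZMod 2) K]

theorem sqOver_map (p : P5) :
    sqOver K (map (algebraMap (ZMod 2) K) p) = map (algebraMap (ZMod 2) K) (Sq p) := by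
  induction p using MvPolynomial.induction_on with
  | C a => simp [sqOver, Sq]
  | add p q hp hq => simp only [map_add, hp, hq]
  | mul_X p i hp =>
    rw [map_mul, map_mul, hp, map_mul, map_mul, map_X, sqOver_X, Sq_X, map_add, map_pow, map_X]

/-- The map on polynomials induced by a linear form on coefficients. -/
def coeffMap (ρ : K →ₗ[ZMod 2] ZMod 2) : MvPolynomial (Fin 5) K →+ P5 where
  toFun := AddMonoidAlgebra.map ρ.toAddMonoidHom
  map_zero' := AddMonoidAlgebra.map_zero _
  map_add' := AddMonoidAlgebra.map_add _

theorem coeff_coeffMap (ρ : K →ₗ[ZMod 2] ZMod 2) (d : Fin 5 →₀ ℕ) (p : MvPolynomial (Fin 5) K) :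
    coeff d (coeffMap ρ p) = ρ (coeff d p) := rfl

theorem coeffMap_smul_map (ρ : K →ₗ[ZMod 2] ZMod 2) (a : K) (p : P5) :
    coeffMap ρ (a • map (algebraMap (ZMod 2) K) p) = ρ a • p := by
  ext d
  rw [coeff_coeffMap, coeff_smul, coeff_map, coeff_smul, smul_eq_mul, smul_eq_mul, mul_comm,
    ← Algebra.smul_def, map_smul, smul_eq_mul, mul_comm]

theorem mem_hits_of_map_mem_hits {n : ℕ} {f : P5}
    (hf : map (algebraMap (ZMod 2) K) f ∈ hits (sqOver K) n) : f ∈ hits Sq n := by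
  obtain ⟨ρ, hρ⟩ := LinearMap.exists_leftInverse_of_injective (Algebra.linearMap (ZMod 2) K)
    (LinearMap.ker_eq_bot.mpr (algebraMap (ZMod 2) K).injective)
  have h1 : ρ 1 = 1 := by
    have := LinearMap.congr_fun hρ 1
    simpa using this
  have h2 := map_mem_hits (coeffMap ρ) (S' := Sq) (n := n)
    (homogeneousComponent_map (coeffMap ρ) (fun m p hp d hd => hp fun h => hd (by
      rw [coeff_coeffMap, h, map_zero])) n) (fun p => ?_) hf
  · have := coeffMap_smul_map ρ 1 f
    rw [one_smul, h1, one_smul] at this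
    rwa [this] at h2
  · induction p using MvPolynomial.induction_on' with
    | add p q hp hq => simp only [map_add, hp, hq]
    | monomial d a =>
      have h : (monomial d a : MvPolynomial (Fin 5) K) =
          a • map (algebraMap (ZMod 2) K) (monomial d 1) := by
        rw [map_monomial, map_one, ← monomial_eq_smul]
      rw [h, map_smul, sqOver_map, coeffMap_smul_map, coeffMap_smul_map, map_smul]

section Root

variable [CharP K 2] {β : K}

theorem conjugate_mul_conjugate (h : β ^ 5 = β ^ 4 + β ^ 2 + β + 1) (i k : Fin 5) :
    conjugate β i * conjugate β (i + k) =
      ∑ j, (mulMatrix : Matrix (Fin 5) (Fin 5) (ZMod 2)) k j • conjugate β (i + j) := by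
  have h0 : conjugate β 0 * conjugate β k =
      ∑ j, (mulMatrix : Matrix (Fin 5) (Fin 5) (ZMod 2)) k j • conjugate β j := by
    have e0 : conjugate β 0 = β := pow_one β
    have e1 : conjugate β 1 = β ^ 2 := rfl
    have e2 : conjugate β 2 = β ^ 4 := rfl
    have e3 : conjugate β 3 = β ^ 8 := rfl
    have e4 : conjugate β 4 = β ^ 16 := rfl
    fin_cases k <;> simp [Fin.sum_univ_five, mulMatrix, e0, e1, e2, e3, e4] <;> grind
  have hstep : ∀ i : Fin 5, conjugate β i * conjugate β (i + k) =
      ∑ j, (mulMatrix : Matrix (Fin 5) (Fin 5) (ZMod 2)) k j • conjugate β (i + j) →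
      conjugate β (i + 1) * conjugate β (i + 1 + k) =
      ∑ j, (mulMatrix : Matrix (Fin 5) (Fin 5) (ZMod 2)) k j • conjugate β (i + 1 + j) := by
    intro i hi
    have h1 : ∀ j, conjugate β (i + 1 + j) = conjugate β (i + j) ^ 2 := fun j => by
      rw [sq_conjugate h, add_right_comm]
    have h2 : ∀ a : ZMod 2, a ^ 2 = a := by decide
    simp_rw [h1]
    rw [← sq_conjugate h, ← mul_pow, hi, CharTwo.sum_sq]
    exact Finset.sum_congr rfl fun j _ => by rw [smul_pow, h2]
  have i0 : conjugate β 0 * conjugate β (0 + k) =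
      ∑ j, (mulMatrix : Matrix (Fin 5) (Fin 5) (ZMod 2)) k j • conjugate β (0 + j) := by
    simpa only [zero_add] using h0
  have i1 := hstep 0 i0
  have i2 := hstep 1 i1
  have i3 := hstep 2 i2
  have i4 := hstep 3 i3
  fin_cases i
  exacts [i0, i1, i2, i3, i4]

theorem sum_conjugate_mul_conjugate (h : β ^ 5 = β ^ 4 + β ^ 2 + β + 1)
    (j k : Fin 5) :
    ∑ i, conjugate β (i + j) * conjugate β (i + k) = if j = k then 1 else 0 := by
  have hs : ∀ j, ∑ i, conjugate β (i + j) = 1 := fun j =>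
    (Equiv.sum_comp (Equiv.addRight j) (conjugate β)).trans (sum_conjugate h)
  have h1 : ∀ i, conjugate β (i + j) * conjugate β (i + k) = ∑ m,
      (mulMatrix : Matrix (Fin 5) (Fin 5) (ZMod 2)) (k - j) m • conjugate β (i + (j + m)) := by
    intro i
    have := conjugate_mul_conjugate h (i + j) (k - j)
    simp_rw [add_assoc] at this
    rwa [add_sub_cancel] at this
  have h2 : ∀ j k : Fin 5, ∑ m, (mulMatrix : Matrix (Fin 5) (Fin 5) (ZMod 2)) (k - j) m =
      if j = k then 1 else 0 := by decide +kernel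
  simp_rw [h1]
  rw [Finset.sum_comm]
  simp_rw [← Finset.smul_sum, hs, ← Finset.sum_smul, h2]
  split_ifs <;> simp

end Root

/-- The change of coordinates diagonalizing the multiplication matrix. -/
def extend (β : K) : P5 →ₐ[ZMod 2] MvPolynomial (Fin 5) K :=
  aeval fun j => ∑ i, conjugate β (i + j) • X i

theorem extend_X (β : K) (j : Fin 5) : extend β (X j) = ∑ i, conjugate β (i + j) • X i := by
  rw [extend, aeval_X]

theorem extend_circMatrix (β : K) (p : P5) :
    extend β (actGL circMatrix p) = circSubst K (extend β p) := by
  refine DFunLike.congr_fun (f := (extend β).comp (actGL circMatrix))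
    (g := ((circSubst K).restrictScalars (ZMod 2)).comp (extend β)) (algHom_ext fun k => ?_) p
  have h1 : actGL circMatrix (X k) = X k + X (k + 4) + X (k + 3) := by
    rw [actGL_X]
    fin_cases k <;> simp [circMatrix, Fin.sum_univ_five] <;> ring
  rw [AlgHom.comp_apply, AlgHom.comp_apply, AlgHom.restrictScalars_apply, h1, map_add, map_add,
    extend_X, extend_X, extend_X, map_sum]
  simp_rw [map_smul, circSubst_X, smul_add, Finset.sum_add_distrib]
  congr 1
  · congr 1
    rw [← Equiv.sum_comp (Equiv.addRight (1 : Fin 5))]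
    refine Finset.sum_congr rfl fun i _ => ?_
    rw [Equiv.coe_addRight, add_comm k 4, ← add_assoc, add_assoc i 1 4,
      show (1 + 4 : Fin 5) = 0 from rfl, add_zero]
  · rw [← Equiv.sum_comp (Equiv.addRight (2 : Fin 5))]
    refine Finset.sum_congr rfl fun i _ => ?_
    rw [Equiv.coe_addRight, add_comm k 3, ← add_assoc, add_assoc i 2 3,
      show (2 + 3 : Fin 5) = 0 from rfl, add_zero]

variable [CharP K 2] {β : K}

theorem extend_Sq (h : β ^ 5 = β ^ 4 + β ^ 2 + β + 1) (p : P5) :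
    extend β (Sq p) = twistedSq K (extend β p) := by
  refine DFunLike.congr_fun (f := (extend β).comp Sq)
    (g := ((twistedSq K).restrictScalars (ZMod 2)).comp (extend β)) (algHom_ext fun j => ?_) p
  rw [AlgHom.comp_apply, AlgHom.comp_apply, AlgHom.restrictScalars_apply, Sq_X, map_add, map_pow,
    extend_X, map_sum, CharTwo.sum_sq]
  simp_rw [map_smul, twistedSq_X, smul_add, Finset.sum_add_distrib, smul_pow, sq_conjugate h]
  rw [add_right_inj]
  rw [← Equiv.sum_comp (Equiv.addRight (4 : Fin 5))]
  refine Finset.sum_congr rfl fun i _ => ?_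
  rw [Equiv.coe_addRight, add_right_comm, add_assoc i 4 1,
    show (4 + 1 : Fin 5) = 0 from rfl, add_zero]

theorem retract_extend (h : β ^ 5 = β ^ 4 + β ^ 2 + β + 1) (p : P5) :
    retract β (extend β p) = map (algebraMap (ZMod 2) K) p := by
  refine DFunLike.congr_fun (f := ((retract β).restrictScalars (ZMod 2)).comp (extend β))
    (g := mapAlgHom (Algebra.ofId (ZMod 2) K)) (algHom_ext fun j => ?_) p
  rw [AlgHom.comp_apply, AlgHom.restrictScalars_apply, extend_X, map_sum, mapAlgHom_apply]
  change _ = map (algebraMap (ZMod 2) K) (X j)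
  rw [map_X]
  simp_rw [map_smul, retract_X, Finset.smul_sum, smul_smul]
  rw [Finset.sum_comm]
  simp_rw [← Finset.sum_smul, sum_conjugate_mul_conjugate h, ite_smul, one_smul, zero_smul]
  rw [Finset.sum_ite_eq, if_pos (Finset.mem_univ _)]

theorem extend_mulMatrix (h : β ^ 5 = β ^ 4 + β ^ 2 + β + 1) (p : P5) :
    extend β (actGL mulMatrix p) = diagSubst β (extend β p) := by
  refine DFunLike.congr_fun (f := (extend β).comp (actGL mulMatrix))
    (g := ((diagSubst β).restrictScalars (ZMod 2)).comp (extend β)) (algHom_ext fun k => ?_) p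
  rw [AlgHom.comp_apply, AlgHom.comp_apply, AlgHom.restrictScalars_apply, actGL_X, map_sum,
    extend_X, map_sum]
  simp_rw [map_smul, extend_X, diagSubst_X, Finset.smul_sum]
  rw [Finset.sum_comm]
  refine Finset.sum_congr rfl fun i _ => ?_
  rw [smul_smul, mul_comm, conjugate_mul_conjugate h, Finset.sum_smul]
  simp_rw [smul_assoc]

theorem mem_hits_of_invariant_of_root (h : β ^ 5 = β ^ 4 + β ^ 2 + β + 1) {D : Cert}
    (hn : D.deg ≤ 31) (hr : 0 < D.rank) (hrows : D.checkRows D.rank D.rows = true)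
    (hcomplete : D.checkComplete = true) (hdual : D.checkDual = true) (hrank : D.checkRank = true)
    {f : P5} (hf : f.IsHomogeneous D.deg) (hinv : ∀ g, actGL g f - f ∈ hits Sq D.deg) :
    f ∈ hits Sq D.deg := by
  have hext : ∀ q ∈ hits Sq D.deg, extend β q ∈ hits (twistedSq K) D.deg := fun q =>
    map_mem_hits (extend β)
      (aeval_homogeneousComponent _ (fun j => isHomogeneous_smul_X _ _ id) _) (extend_Sq h)
  have hdiag : ∀ q ∈ hits (twistedSq K) D.deg, diagSubst β q ∈ hits (twistedSq K) D.deg :=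
    fun q => map_mem_hits (diagSubst β)
      (aeval_homogeneousComponent _ (fun i => by
        simpa using isHomogeneous_smul_X {i} (conjugate β) id) _) (diagSubst_twistedSq h)
  have hcirc : ∀ q ∈ hits (twistedSq K) D.deg, circSubst K q ∈ hits (twistedSq K) D.deg :=
    fun q => map_mem_hits (circSubst K)
      (aeval_homogeneousComponent _ (fun i =>
        ((isHomogeneous_X _ _).add (isHomogeneous_X _ _)).add (isHomogeneous_X _ _)) _)
      circSubst_twistedSq
  set F := extend β f with hF
  have hFh : F.IsHomogeneous D.deg := by
    simpa [hF, extend] using hf.aeval _ fun j =>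
      isHomogeneous_smul_X _ (fun i => conjugate β (i + j)) id
  have h1 : diagSubst β F - F ∈ hits (twistedSq K) D.deg := by
    rw [hF, ← extend_mulMatrix h, ← map_sub]
    exact hext _ (hinv _)
  have h2 : circSubst K F - F ∈ hits (twistedSq K) D.deg := by
    rw [hF, ← extend_circMatrix, ← map_sub]
    exact hext _ (hinv _)
  set G := ∑ k ∈ Finset.range 31, (diagSubst β)^[k] F with hG
  have h3 : G - F ∈ hits (twistedSq K) D.deg := by
    have h31 : (31 : ℕ) • F = F := by
      rw [succ_nsmul, show 30 = 2 * 15 from rfl, mul_nsmul, CharTwo.two_nsmul, smul_zero, zero_add]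
    have : G - F = ∑ k ∈ Finset.range 31, ((diagSubst β)^[k] F - F) := by
      rw [Finset.sum_sub_distrib, Finset.sum_const, Finset.card_range, h31]
    rw [this]
    exact Submodule.sum_mem _ fun k _ => iterate_sub_mem_hits hdiag h1 k
  have hcoeff : ∀ d, coeff d G = (if encode d % 31 = 0 then 1 else 0) * coeff d F := by
    intro d
    have hk : ∀ k, coeff d ((diagSubst β)^[k] F) =
        (β ^ ∑ i : Fin 5, 2 ^ (i : ℕ) * d i) ^ k * coeff d F := by
      intro k
      induction k with
      | zero => simp
      | succ k ih =>
        rw [Function.iterate_succ_apply', coeff_diagSubst, ih, ← mul_assoc, ← pow_succ']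
    rw [hG, coeff_sum, encode_mod, ← geom_sum_root h, Finset.sum_mul]
    exact Finset.sum_congr rfl fun k _ => hk k
  have h4 : G ∈ hits (twistedSq K) D.deg := by
    refine Cert.mem_hits hn hr hrows hcomplete hdual hrank (fun d hd => hFh fun h0 => hd ?_)
      (fun d hd => ?_) hcirc ?_
    · rw [hcoeff, h0, mul_zero]
    · by_contra h0
      rw [mem_support_iff, hcoeff, if_neg h0, zero_mul] at hd
      exact hd rfl
    · have : circSubst K G - G = circSubst K (G - F) - (G - F) + (circSubst K F - F) := by
        rw [map_sub]; ring
      rw [this]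
      exact Submodule.add_mem _ (Submodule.sub_mem _ (hcirc _ h3) h3) h2
  have h5 : F ∈ hits (twistedSq K) D.deg := by
    have := Submodule.sub_mem _ h4 h3
    rwa [sub_sub_cancel] at this
  refine mem_hits_of_map_mem_hits (K := K) ?_
  rw [← retract_extend h]
  exact map_mem_hits (retract β)
    (aeval_homogeneousComponent _ (fun i => isHomogeneous_smul_X _ _ id) _)
    (retract_twistedSq h) h5

end BaseCases

theorem mem_hits_of_invariant_of_cert {D : Cert}
    (hn : D.deg ≤ 31) (hr : 0 < D.rank) (hrows : D.checkRows D.rank D.rows = true)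
    (hcomplete : D.checkComplete = true) (hdual : D.checkDual = true) (hrank : D.checkRank = true)
    {f : P5} (hf : f.IsHomogeneous D.deg) (hinv : ∀ g, actGL g f - f ∈ hits Sq D.deg) :
    f ∈ hits Sq D.deg := by
  have : CharP (AlgebraicClosure (ZMod 2)) 2 := charP_of_injective_algebraMap' (ZMod 2) 2
  obtain ⟨β, hβ⟩ := exists_root (AlgebraicClosure (ZMod 2))
  exact mem_hits_of_invariant_of_root hβ hn hr hrows hcomplete hdual hrank hf hinv

/-- The codes of the monomials of weight zero in degree `9`. -/
def certNineMons : List ℕ :=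
  [117706752, 1839168, 17838144, 67899393, 83898369, 28737, 34087104, 34091010, 34340994, 50339970,
  532611, 33837120, 18088128, 50336064, 84148353, 278721, 528705, 16777665, 18092034, 282627,
  16781571, 50593860, 786501, 16785477, 17039367]

/-- The indices of the monomials of weight zero in degree `9`. -/
def certNineIndex : SearchTree :=
  .node 18088128 12 (.node 1839168 1 (.node 528705 16 (.node 278721 15 (.node 28737 5 .leaf .leaf)
  (.node 282627 19 .leaf .leaf)) (.node 786501 22 (.node 532611 10 .leaf .leaf) .leaf)) (.node
  16785477 23 (.node 16781571 20 (.node 16777665 17 .leaf .leaf) .leaf) (.node 17838144 2 (.node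
  17039367 24 .leaf .leaf) .leaf))) (.node 50339970 9 (.node 34091010 7 (.node 33837120 11 (.node
  18092034 18 .leaf .leaf) (.node 34087104 6 .leaf .leaf)) (.node 50336064 13 (.node 34340994 8
  .leaf .leaf) .leaf)) (.node 83898369 4 (.node 67899393 3 (.node 50593860 21 .leaf .leaf) .leaf)
  (.node 117706752 0 (.node 84148353 14 .leaf .leaf) .leaf)))

/-- The values of the dual functionals on monomials of degree `9`. -/
def certNineDual : SearchTree :=
  .node 16785477 62 (.node 528705 62 (.node 278721 58 (.node 28737 62 (.node 4293 3 .leaf .leaf)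
  .leaf) (.node 282627 4 .leaf .leaf)) (.node 806976 32 (.node 786501 58 .leaf .leaf) (.node
  16777665 62 .leaf .leaf))) (.node 17563716 20 (.node 17055936 20 (.node 17039367 4 (.node
  16805952 52 .leaf .leaf) .leaf) (.node 17305920 52 .leaf .leaf)) (.node 67899393 4 (.node
  67371075 60 .leaf .leaf) (.node 84148353 4 .leaf .leaf)))

/-- The sources of hit polynomials of degree `9`. -/
def certNineRows : List (List ℕ) :=
  [[34091072, 34341056, 50340032, 17043521, 532673], [34091072], [34341056], [50340032],
  [17043521], [34345024], [50597952, 50597890], [50344000], [17043459], [790593, 790531], [536641],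
  [16789569, 16789507], [50597952], [790593], [16789569], [50593984], [786625], [16785601],
  [17039553]]

/-- The data for verifying the vanishing of invariants in degree `9`. -/
def certNine : Cert where
  deg := 9
  size := 25
  rank := 6
  mons := pack certNineMons
  index := certNineIndex
  dual := certNineDual
  rows := certNineRows

/-- The codes of the monomials of weight zero in degree `23`. -/
def certTwentyThreeMons : List ℕ :=
  [54280256, 118276160, 218394752, 70529216, 86528192, 118526144, 18657536, 86778176, 218894720,
  103027136, 135025088, 51655424, 120340481, 236458049, 84467777, 120590465, 152588417, 252707009,
  36720833, 152838401, 848129, 36970817, 169087361, 1848065, 202649666, 218648642, 201339203,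
  19165316, 291524, 1355909, 102527168, 119026112, 101216705, 35410370, 252457025, 20721857,
  52719809, 152842307, 184840259, 17100995, 138149888, 154148864, 170147840, 202145792, 218144768,
  2158592, 134275136, 2408576, 186646784, 2658560, 134775104, 18907520, 235143680, 3158528,
  67154432, 135275072, 3408512, 67404416, 35656448, 167772992, 33728, 136339457, 136839425,
  201335297, 2098049, 134529026, 151027970, 135528962, 37634, 134218499, 2916356, 18915332,
  35914244, 41540, 2105861, 295430, 251658248, 3674120, 35672072, 67670024, 135790664, 167788616,
  19923080, 83918984, 49352, 100667912, 1049288, 201850889, 2113673, 67109513, 152043530, 53258,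
  1053194, 134234123, 52428812, 557132, 33555020, 2621453, 16809998, 527, 34156544, 38281280,
  34406528, 50405504, 302514368, 533696, 598145, 38535170, 302518274, 54534146, 318767234, 537602,
  787586, 16786562, 4726787, 268959875, 33562832, 33566738, 33816722, 8339, 18157568, 22282304,
  286265408, 84153344, 283712, 16782656, 88342529, 352325633, 348161, 4472897, 268456001, 16847105,
  20971841, 17040452, 17104901, 285212741, 1314896, 67375121, 4433, 262229, 70279232, 202395776,
  202645760, 218644736, 34656512, 70779200, 102777152, 67654400, 83903360, 168837377, 1098113,
  70533122, 87032066, 3162434, 67158338, 68158274, 69222659, 202903556, 234901508, 34914308,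
  219152516, 3166340, 67162244, 135282884, 3416324, 19415300, 51413252, 67412228, 67912196,
  83911172, 68162180, 84411140, 541508, 1105925, 201343109, 1605893, 33603845, 34603781, 135286790,
  16794374, 68169992, 68419976, 68173898, 68427788, 84426764, 100925708, 1057100, 34619405,
  67117325, 1310990, 170397824, 19407488, 168337409, 33596033, 2662466, 134779010, 151527938,
  35660354, 167776898, 35922056, 34111625, 168042506, 36175946, 303242, 17302154, 86278208,
  19157504, 151274048, 152338433, 1348097, 69468737, 151031876, 153096197, 134222405, 299336,
  16798280, 17862665, 85983305, 2363657, 134480201, 302264384, 54530240, 4722881, 268705985,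
  34345985, 50344961, 50594945, 50659394, 268709891, 852035, 16851011, 20975747, 17313872,
  17563856, 17567762, 186146816, 102277184, 18407552, 234893696, 2908544, 34906496, 50905472,
  35156480, 35406464, 51405440, 51905408, 67904384, 104341505, 1598081, 34096001, 86532098,
  102531074, 118530050, 34660418, 70783106, 102781058, 202899650, 234897602, 103031042, 135028994,
  35160386, 135278978, 67658306, 287618, 36724739, 68722691, 100720643, 37224707, 101220611,
  101720579, 50913284, 235151492, 35164292, 103284932, 35664260, 167780804, 51913220, 169345157,
  34103813, 103288838, 235405382, 119537798, 135536774, 151535750, 3670214, 35668166, 67666118,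
  167784710, 168034694, 45446, 545414, 100664006, 795398, 69730439, 134226311, 51921032, 67920008,
  84418952, 549320, 34611593, 553226, 100671818, 803210, 16802186, 102236171, 100675724, 811022,
  1061006, 17309966, 33558926, 68468801, 84967745, 17847041, 87035972, 135532868, 69226565,
  201593093, 18104837, 84168968, 17056076, 134525120, 51155456, 151524032, 36470849, 52469825,
  136589441, 184586369, 185336321, 17347073, 17597057, 186650690, 18911426, 19661378, 52723715,
  136843331, 153092291, 33849923, 2101955, 19673096, 151789640, 168038600, 799304, 17048264,
  33861641, 134230217, 50860553, 17052170, 2367563, 50364491, 134484107, 119030018, 35414276,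
  67662212, 68166086, 101728391, 50655488, 151024064, 119276096, 20471873, 68718785, 100716737,
  184836353, 52969793, 100966721, 17097089, 69218753, 85467713, 101466689, 117465665, 101716673,
  33846017, 117965633, 18097025, 18661442, 235147586, 19161410, 151277954, 3412418, 67408322,
  51659330, 83907266, 84157250, 252710915, 20725763, 84721667, 168841283, 84971651, 1102019,
  1352003, 17350979, 69472643, 201589187, 85721603, 117719555, 1851971, 17850947, 18350915,
  50348867, 218902532, 103034948, 135032900, 151281860, 151531844, 19665284, 151781828, 84161156,
  791492, 16790468, 169095173, 185094149, 37228613, 101224517, 17354885, 53477573, 69476549,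
  117473477, 17604869, 33853829, 18354821, 50352773, 50602757, 151285766, 3420230, 19419206,
  51417158, 67416134, 151785734, 35918150, 84415046, 17044358, 53481479, 69480455, 117477383,
  185598023, 201596999, 1609799, 33607751, 17858759, 2109767, 2359751, 34607687, 51671048,
  52171016, 1863689, 101982281, 117981257, 18112649, 18362633, 34361609, 50360585, 18612617,
  50610569, 84172874, 68423882, 84672842, 18366539, 34865483, 67113419, 84676748, 807116, 16806092,
  17306060, 18620429, 50618381, 34869389, 51118349, 100929614, 17059982, 67121231, 67371215,
  118776128, 68968769, 85221635, 119033924, 51663236, 85475525, 101724485, 1855877, 17854853,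
  101974469, 67916102, 83915078, 84165062, 85479431, 101978375, 186396800, 168587393, 185086337,
  86782082, 218898626, 2912450, 34910402, 50909378, 51159362, 19411394, 51909314, 67908290,
  36974723, 52973699, 100970627, 169091267, 185090243, 53223683, 33599939, 117969539, 34099907,
  34349891, 51163268, 185344133, 34353797, 19669190, 33857735, 50856647, 52174922, 84422858,
  118235147, 34365515, 34615499, 50864459, 50868365, 118780034, 119280002, 51409346, 68972675,
  85471619, 101470595, 117469571, 1601987, 119283908, 101474501, 117973445, 119287814, 35418182,
  51667142, 51917126, 52167110, 101478407, 85729415, 117727367, 1859783, 117977351, 34107719,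
  118227335, 18358727, 34357703, 50356679, 85217729, 85225541, 85725509, 117723461, 18108743,
  84717761, 53219777, 117715649, 185340227, 17600963, 18100931, 50598851, 53227589, 17608775,
  50606663, 118231241, 18616523, 50614475, 51122255]

/-- The indices of the monomials of weight zero in degree `23`. -/
def certTwentyThreeIndex : SearchTree :=
  .node 67113419 457 (.node 19161410 375 (.node 2916356 70 (.node 1053194 92 (.node 533696 105
  (.node 53258 91 (.node 37634 68 (.node 8339 119 (.node 4433 138 (.node 527 99 .leaf .leaf) .leaf)
  (.node 33728 60 .leaf .leaf)) (.node 45446 289 (.node 41540 73 .leaf .leaf) (.node 49352 84 .leaf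
  .leaf))) (.node 295430 75 (.node 287618 263 (.node 283712 124 (.node 262229 139 .leaf .leaf)
  .leaf) (.node 291524 28 .leaf .leaf)) (.node 303242 203 (.node 299336 214 .leaf .leaf) (.node
  348161 128 .leaf .leaf)))) (.node 791492 406 (.node 553226 300 (.node 545414 290 (.node 541508
  172 (.node 537602 111 .leaf .leaf) .leaf) (.node 549320 298 .leaf .leaf)) (.node 598145 106
  (.node 557132 95 .leaf .leaf) (.node 787586 112 .leaf .leaf))) (.node 811022 306 (.node 803210
  302 (.node 799304 341 (.node 795398 292 .leaf .leaf) .leaf) (.node 807116 459 .leaf .leaf))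
  (.node 852035 229 (.node 848129 20 .leaf .leaf) (.node 1049288 86 .leaf .leaf))))) (.node 1859783
  539 (.node 1352003 388 (.node 1105925 173 (.node 1098113 150 (.node 1061006 307 (.node 1057100
  186 .leaf .leaf) .leaf) (.node 1102019 387 .leaf .leaf)) (.node 1314896 136 (.node 1310990 189
  .leaf .leaf) (.node 1348097 209 .leaf .leaf))) (.node 1609799 435 (.node 1601987 527 (.node
  1598081 248 (.node 1355909 29 .leaf .leaf) .leaf) (.node 1605893 175 .leaf .leaf)) (.node 1851971
  394 (.node 1848065 23 .leaf .leaf) (.node 1855877 477 .leaf .leaf)))) (.node 2363657 218 (.node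
  2109767 438 (.node 2101955 337 (.node 2098049 64 (.node 1863689 443 .leaf .leaf) .leaf) (.node
  2105861 74 .leaf .leaf)) (.node 2158592 45 (.node 2113673 88 .leaf .leaf) (.node 2359751 439
  .leaf .leaf))) (.node 2658560 49 (.node 2408576 47 (.node 2367563 347 .leaf .leaf) (.node 2621453
  97 .leaf .leaf)) (.node 2908544 239 (.node 2662466 194 .leaf .leaf) (.node 2912450 490 .leaf
  .leaf)))))) (.node 17347073 328 (.node 16802186 303 (.node 3674120 77 (.node 3412418 377 (.node
  3166340 161 (.node 3162434 153 (.node 3158528 53 .leaf .leaf) .leaf) (.node 3408512 56 .leaf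
  .leaf)) (.node 3420230 422 (.node 3416324 164 .leaf .leaf) (.node 3670214 284 .leaf .leaf)))
  (.node 16786562 113 (.node 4726787 114 (.node 4722881 222 (.node 4472897 129 .leaf .leaf) .leaf)
  (.node 16782656 125 .leaf .leaf)) (.node 16794374 179 (.node 16790468 407 .leaf .leaf) (.node
  16798280 215 .leaf .leaf)))) (.node 17056076 319 (.node 17040452 133 (.node 16847105 131 (.node
  16809998 98 (.node 16806092 460 .leaf .leaf) .leaf) (.node 16851011 230 .leaf .leaf)) (.node
  17048264 342 (.node 17044358 429 .leaf .leaf) (.node 17052170 346 .leaf .leaf))) (.node 17302154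
  204 (.node 17100995 39 (.node 17097089 364 (.node 17059982 467 .leaf .leaf) .leaf) (.node
  17104901 134 .leaf .leaf)) (.node 17309966 308 (.node 17306060 461 .leaf .leaf) (.node 17313872
  232 .leaf .leaf))))) (.node 18112649 446 (.node 17847041 312 (.node 17597057 329 (.node 17563856
  233 (.node 17354885 412 (.node 17350979 389 .leaf .leaf) .leaf) (.node 17567762 234 .leaf .leaf))
  (.node 17604869 416 (.node 17600963 555 .leaf .leaf) (.node 17608775 559 .leaf .leaf))) (.node
  18097025 372 (.node 17858759 437 (.node 17854853 478 (.node 17850947 395 .leaf .leaf) .leaf)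
  (.node 17862665 216 .leaf .leaf)) (.node 18104837 317 (.node 18100931 556 .leaf .leaf) (.node
  18108743 550 .leaf .leaf)))) (.node 18616523 562 (.node 18362633 447 (.node 18354821 418 (.node
  18350915 396 (.node 18157568 120 .leaf .leaf) .leaf) (.node 18358727 543 .leaf .leaf)) (.node
  18407552 237 (.node 18366539 455 .leaf .leaf) (.node 18612617 450 .leaf .leaf))) (.node 18907520
  51 (.node 18657536 6 (.node 18620429 462 .leaf .leaf) (.node 18661442 373 .leaf .leaf)) (.node
  18915332 71 (.node 18911426 331 .leaf .leaf) (.node 19157504 206 .leaf .leaf))))))) (.node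
  36175946 202 (.node 34156544 100 (.node 33558926 309 (.node 19673096 338 (.node 19419206 423
  (.node 19411394 494 (.node 19407488 191 (.node 19165316 27 .leaf .leaf) .leaf) (.node 19415300
  165 .leaf .leaf)) (.node 19665284 403 (.node 19661378 332 .leaf .leaf) (.node 19669190 510 .leaf
  .leaf))) (.node 20971841 132 (.node 20721857 35 (.node 20471873 358 (.node 19923080 82 .leaf
  .leaf) .leaf) (.node 20725763 383 .leaf .leaf)) (.node 22282304 121 (.node 20975747 231 .leaf
  .leaf) (.node 33555020 96 .leaf .leaf)))) (.node 33849923 336 (.node 33603845 176 (.node 33596033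
  193 (.node 33566738 117 (.node 33562832 116 .leaf .leaf) .leaf) (.node 33599939 503 .leaf .leaf))
  (.node 33816722 118 (.node 33607751 436 .leaf .leaf) (.node 33846017 370 .leaf .leaf))) (.node
  34099907 505 (.node 33861641 343 (.node 33857735 511 (.node 33853829 417 .leaf .leaf) .leaf)
  (.node 34096001 249 .leaf .leaf)) (.node 34107719 541 (.node 34103813 278 .leaf .leaf) (.node
  34111625 200 .leaf .leaf))))) (.node 34910402 491 (.node 34607687 440 (.node 34361609 448 (.node
  34353797 509 (.node 34349891 506 (.node 34345985 224 .leaf .leaf) .leaf) (.node 34357703 544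
  .leaf .leaf)) (.node 34406528 102 (.node 34365515 516 .leaf .leaf) (.node 34603781 177 .leaf
  .leaf))) (.node 34660418 253 (.node 34619405 187 (.node 34615499 517 (.node 34611593 299 .leaf
  .leaf) .leaf) (.node 34656512 144 .leaf .leaf)) (.node 34869389 464 (.node 34865483 456 .leaf
  .leaf) (.node 34906496 240 .leaf .leaf)))) (.node 35656448 58 (.node 35406464 243 (.node 35160386
  260 (.node 35156480 242 (.node 34914308 159 .leaf .leaf) .leaf) (.node 35164292 272 .leaf .leaf))
  (.node 35414276 351 (.node 35410370 33 .leaf .leaf) (.node 35418182 532 .leaf .leaf))) (.node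
  35672072 78 (.node 35664260 274 (.node 35660354 197 .leaf .leaf) (.node 35668166 285 .leaf
  .leaf)) (.node 35918150 427 (.node 35914244 72 .leaf .leaf) (.node 35922056 199 .leaf .leaf))))))
  (.node 51155456 321 (.node 50598851 557 (.node 38535170 107 (.node 36974723 497 (.node 36724739
  264 (.node 36720833 18 (.node 36470849 323 .leaf .leaf) .leaf) (.node 36970817 21 .leaf .leaf))
  (.node 37228613 410 (.node 37224707 267 .leaf .leaf) (.node 38281280 101 .leaf .leaf))) (.node
  50360585 449 (.node 50352773 419 (.node 50348867 397 (.node 50344961 225 .leaf .leaf) .leaf)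
  (.node 50356679 545 .leaf .leaf)) (.node 50405504 103 (.node 50364491 348 .leaf .leaf) (.node
  50594945 226 .leaf .leaf)))) (.node 50860553 345 (.node 50618381 463 (.node 50610569 451 (.node
  50606663 560 (.node 50602757 420 .leaf .leaf) .leaf) (.node 50614475 563 .leaf .leaf)) (.node
  50659394 227 (.node 50655488 355 .leaf .leaf) (.node 50856647 512 .leaf .leaf))) (.node 50909378
  492 (.node 50868365 519 (.node 50864459 518 .leaf .leaf) (.node 50905472 241 .leaf .leaf)) (.node
  51118349 465 (.node 50913284 270 .leaf .leaf) (.node 51122255 564 .leaf .leaf))))) (.node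
  52171016 442 (.node 51663236 474 (.node 51413252 166 (.node 51405440 244 (.node 51163268 507
  (.node 51159362 493 .leaf .leaf) .leaf) (.node 51409346 522 .leaf .leaf)) (.node 51655424 11
  (.node 51417158 424 .leaf .leaf) (.node 51659330 379 .leaf .leaf))) (.node 51913220 276 (.node
  51905408 245 (.node 51671048 441 (.node 51667142 533 .leaf .leaf) .leaf) (.node 51909314 495
  .leaf .leaf)) (.node 51921032 295 (.node 51917126 534 .leaf .leaf) (.node 52167110 535 .leaf
  .leaf)))) (.node 53223683 502 (.node 52723715 333 (.node 52469825 324 (.node 52428812 94 (.node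
  52174922 513 .leaf .leaf) .leaf) (.node 52719809 36 .leaf .leaf)) (.node 52973699 498 (.node
  52969793 362 .leaf .leaf) (.node 53219777 552 .leaf .leaf))) (.node 54280256 0 (.node 53477573
  413 (.node 53227589 558 .leaf .leaf) (.node 53481479 430 .leaf .leaf)) (.node 54534146 109 (.node
  54530240 221 .leaf .leaf) (.node 67109513 89 .leaf .leaf)))))))) (.node 118276160 1 (.node
  85217729 546 (.node 69222659 156 (.node 67908290 496 (.node 67408322 378 (.node 67162244 162
  (.node 67154432 54 (.node 67121231 468 (.node 67117325 188 .leaf .leaf) .leaf) (.node 67158338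
  154 .leaf .leaf)) (.node 67375121 137 (.node 67371215 469 .leaf .leaf) (.node 67404416 57 .leaf
  .leaf))) (.node 67662212 352 (.node 67654400 147 (.node 67416134 425 (.node 67412228 167 .leaf
  .leaf) .leaf) (.node 67658306 262 .leaf .leaf)) (.node 67670024 79 (.node 67666118 286 .leaf
  .leaf) (.node 67904384 246 .leaf .leaf)))) (.node 68419976 181 (.node 68162180 170 (.node
  67920008 296 (.node 67916102 480 (.node 67912196 168 .leaf .leaf) .leaf) (.node 68158274 155
  .leaf .leaf)) (.node 68169992 180 (.node 68166086 353 .leaf .leaf) (.node 68173898 182 .leaf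
  .leaf))) (.node 68722691 265 (.node 68468801 310 (.node 68427788 183 (.node 68423882 453 .leaf
  .leaf) .leaf) (.node 68718785 359 .leaf .leaf)) (.node 68972675 523 (.node 68968769 471 .leaf
  .leaf) (.node 69218753 365 .leaf .leaf))))) (.node 84157250 381 (.node 70533122 151 (.node
  69480455 431 (.node 69472643 390 (.node 69468737 210 (.node 69226565 315 .leaf .leaf) .leaf)
  (.node 69476549 414 .leaf .leaf)) (.node 70279232 140 (.node 69730439 293 .leaf .leaf) (.node
  70529216 3 .leaf .leaf))) (.node 83911172 169 (.node 83903360 148 (.node 70783106 254 (.node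
  70779200 145 .leaf .leaf) .leaf) (.node 83907266 380 .leaf .leaf)) (.node 83918984 83 (.node
  83915078 481 .leaf .leaf) (.node 84153344 123 .leaf .leaf)))) (.node 84426764 184 (.node 84411140
  171 (.node 84168968 318 (.node 84165062 482 (.node 84161156 405 .leaf .leaf) .leaf) (.node
  84172874 452 .leaf .leaf)) (.node 84418952 297 (.node 84415046 428 .leaf .leaf) (.node 84422858
  514 .leaf .leaf))) (.node 84717761 551 (.node 84672842 454 (.node 84467777 14 .leaf .leaf) (.node
  84676748 458 .leaf .leaf)) (.node 84967745 311 (.node 84721667 384 .leaf .leaf) (.node 84971651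
  386 .leaf .leaf)))))) (.node 101716673 369 (.node 88342529 126 (.node 85729415 537 (.node
  85475525 475 (.node 85467713 366 (.node 85225541 547 (.node 85221635 472 .leaf .leaf) .leaf)
  (.node 85471619 524 .leaf .leaf)) (.node 85721603 392 (.node 85479431 483 .leaf .leaf) (.node
  85725509 548 .leaf .leaf))) (.node 86778176 7 (.node 86528192 4 (.node 86278208 205 (.node
  85983305 217 .leaf .leaf) .leaf) (.node 86532098 250 .leaf .leaf)) (.node 87032066 152 (.node
  86782082 488 .leaf .leaf) (.node 87035972 313 .leaf .leaf)))) (.node 100966721 363 (.node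
  100716737 360 (.node 100671818 301 (.node 100667912 85 (.node 100664006 291 .leaf .leaf) .leaf)
  (.node 100675724 305 .leaf .leaf)) (.node 100925708 185 (.node 100720643 266 .leaf .leaf) (.node
  100929614 466 .leaf .leaf))) (.node 101466689 367 (.node 101220611 268 (.node 101216705 32 (.node
  100970627 499 .leaf .leaf) .leaf) (.node 101224517 411 .leaf .leaf)) (.node 101474501 529 (.node
  101470595 525 .leaf .leaf) (.node 101478407 536 .leaf .leaf))))) (.node 104341505 247 (.node
  102527168 30 (.node 101978375 484 (.node 101728391 354 (.node 101724485 476 (.node 101720579 269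
  .leaf .leaf) .leaf) (.node 101974469 479 .leaf .leaf)) (.node 102236171 304 (.node 101982281 444
  .leaf .leaf) (.node 102277184 236 .leaf .leaf))) (.node 103031042 258 (.node 102781058 255 (.node
  102777152 146 (.node 102531074 251 .leaf .leaf) .leaf) (.node 103027136 9 .leaf .leaf)) (.node
  103284932 273 (.node 103034948 399 .leaf .leaf) (.node 103288838 279 .leaf .leaf)))) (.node
  117965633 371 (.node 117715649 553 (.node 117473477 415 (.node 117469571 526 (.node 117465665 368
  .leaf .leaf) .leaf) (.node 117477383 432 .leaf .leaf)) (.node 117723461 549 (.node 117719555 393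
  .leaf .leaf) (.node 117727367 538 .leaf .leaf))) (.node 117981257 445 (.node 117973445 530 (.node
  117969539 504 .leaf .leaf) (.node 117977351 540 .leaf .leaf)) (.node 118231241 561 (.node
  118227335 542 .leaf .leaf) (.node 118235147 515 .leaf .leaf))))))) (.node 168038600 340 (.node
  135536774 282 (.node 134230217 344 (.node 119280002 521 (.node 119026112 31 (.node 118776128 470
  (.node 118530050 252 (.node 118526144 5 .leaf .leaf) .leaf) (.node 118780034 520 .leaf .leaf))
  (.node 119033924 473 (.node 119030018 350 .leaf .leaf) (.node 119276096 357 .leaf .leaf))) (.node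
  120590465 15 (.node 119537798 281 (.node 119287814 531 (.node 119283908 528 .leaf .leaf) .leaf)
  (.node 120340481 12 .leaf .leaf)) (.node 134222405 213 (.node 134218499 69 .leaf .leaf) (.node
  134226311 294 .leaf .leaf)))) (.node 135025088 10 (.node 134525120 320 (.node 134480201 219
  (.node 134275136 46 (.node 134234123 93 .leaf .leaf) .leaf) (.node 134484107 349 .leaf .leaf))
  (.node 134775104 50 (.node 134529026 65 .leaf .leaf) (.node 134779010 195 .leaf .leaf))) (.node
  135282884 163 (.node 135275072 55 (.node 135032900 400 (.node 135028994 259 .leaf .leaf) .leaf)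
  (.node 135278978 261 .leaf .leaf)) (.node 135528962 67 (.node 135286790 178 .leaf .leaf) (.node
  135532868 314 .leaf .leaf))))) (.node 151781828 404 (.node 151031876 211 (.node 136843331 334
  (.node 136589441 325 (.node 136339457 61 (.node 135790664 80 .leaf .leaf) .leaf) (.node 136839425
  62 .leaf .leaf)) (.node 151024064 356 (.node 138149888 40 .leaf .leaf) (.node 151027970 66 .leaf
  .leaf))) (.node 151524032 322 (.node 151281860 401 (.node 151277954 376 (.node 151274048 207
  .leaf .leaf) .leaf) (.node 151285766 421 .leaf .leaf)) (.node 151531844 402 (.node 151527938 196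
  .leaf .leaf) (.node 151535750 283 .leaf .leaf)))) (.node 153096197 212 (.node 152588417 16 (.node
  152043530 90 (.node 151789640 339 (.node 151785734 426 .leaf .leaf) .leaf) (.node 152338433 208
  .leaf .leaf)) (.node 152842307 37 (.node 152838401 19 .leaf .leaf) (.node 153092291 335 .leaf
  .leaf))) (.node 167780804 275 (.node 167772992 59 (.node 154148864 41 .leaf .leaf) (.node
  167776898 198 .leaf .leaf)) (.node 167788616 81 (.node 167784710 287 .leaf .leaf) (.node
  168034694 288 .leaf .leaf)))))) (.node 202645760 142 (.node 185336321 327 (.node 169345157 277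
  (.node 168841283 385 (.node 168587393 486 (.node 168337409 192 (.node 168042506 201 .leaf .leaf)
  .leaf) (.node 168837377 149 .leaf .leaf)) (.node 169091267 500 (.node 169087361 22 .leaf .leaf)
  (.node 169095173 408 .leaf .leaf))) (.node 184840259 38 (.node 184586369 326 (.node 170397824 190
  (.node 170147840 42 .leaf .leaf) .leaf) (.node 184836353 361 .leaf .leaf)) (.node 185090243 501
  (.node 185086337 487 .leaf .leaf) (.node 185094149 409 .leaf .leaf)))) (.node 201339203 26 (.node
  186396800 485 (.node 185598023 433 (.node 185344133 508 (.node 185340227 554 .leaf .leaf) .leaf)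
  (.node 186146816 235 .leaf .leaf)) (.node 186650690 330 (.node 186646784 48 .leaf .leaf) (.node
  201335297 63 .leaf .leaf))) (.node 201596999 434 (.node 201589187 391 (.node 201343109 174 .leaf
  .leaf) (.node 201593093 316 .leaf .leaf)) (.node 202145792 43 (.node 201850889 87 .leaf .leaf)
  (.node 202395776 141 .leaf .leaf))))) (.node 235405382 280 (.node 218898626 489 (.node 218394752
  2 (.node 202903556 157 (.node 202899650 256 (.node 202649666 24 .leaf .leaf) .leaf) (.node
  218144768 44 .leaf .leaf)) (.node 218648642 25 (.node 218644736 143 .leaf .leaf) (.node 218894720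
  8 .leaf .leaf))) (.node 234901508 158 (.node 234893696 238 (.node 219152516 160 (.node 218902532
  398 .leaf .leaf) .leaf) (.node 234897602 257 .leaf .leaf)) (.node 235147586 374 (.node 235143680
  52 .leaf .leaf) (.node 235151492 271 .leaf .leaf)))) (.node 268959875 115 (.node 252710915 382
  (.node 252457025 34 (.node 251658248 76 (.node 236458049 13 .leaf .leaf) .leaf) (.node 252707009
  17 .leaf .leaf)) (.node 268705985 223 (.node 268456001 130 .leaf .leaf) (.node 268709891 228
  .leaf .leaf))) (.node 302514368 104 (.node 286265408 122 (.node 285212741 135 .leaf .leaf) (.node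
  302264384 220 .leaf .leaf)) (.node 318767234 110 (.node 302518274 108 .leaf .leaf) (.node
  352325633 127 .leaf .leaf))))))))

/-- The values of the dual functionals on monomials of degree `23`. -/
def certTwentyThreeDual : SearchTree :=
  .node 53223683 486682256 (.node 20451335 257823371 (.node 17100995 725469663984 (.node 1835339
  722330805 (.node 1069763 822697505 (.node 577607 36534305 (.node 319811 489790696 (.node 291524
  795888275 (.node 274892 796027538 .leaf .leaf) .leaf) (.node 569795 3197298386 (.node 323717
  728830654 .leaf .leaf) .leaf)) (.node 815873 155648529 (.node 807116 795888275 (.node 791492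
  795888275 .leaf .leaf) .leaf) (.node 827591 9984709768 (.node 823685 728830654 .leaf .leaf)
  .leaf))) (.node 1352003 505672792 (.node 1323653 541843546 (.node 1319747 155971278 (.node
  1077575 38557087 .leaf .leaf) .leaf) (.node 1335371 343568934 (.node 1327559 738560892 .leaf
  .leaf) .leaf)) (.node 1585355 2415564109 (.node 1577543 36534305 (.node 1355909 710127707 .leaf
  .leaf) .leaf) (.node 1601987 710127707 .leaf .leaf)))) (.node 3940673 575015547 (.node 2359751
  789345964 (.node 1859783 889939602 (.node 1855877 710127707 (.node 1839245 274765266 .leaf .leaf)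
  .leaf) (.node 2109767 789345964 (.node 1880258 458029306 .leaf .leaf) .leaf)) (.node 2912450
  24846993 (.node 2388038 255708837 (.node 2380226 255708837 .leaf .leaf) .leaf) (.node 3690689
  822697505 .leaf .leaf))) (.node 17044358 24846993 (.node 16806092 772499458 (.node 16790468
  772499458 (.node 3944579 12161836240 .leaf .leaf) .leaf) (.node 16826567 36534305 (.node 16822661
  1062292134 .leaf .leaf) .leaf)) (.node 17068739 894242753425 (.node 17064833 6373731911 (.node
  17059982 24846993 .leaf .leaf) .leaf) (.node 17076551 12776909378 .leaf .leaf))))) (.node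
  18133124 337664024 (.node 17588237 6065037892 (.node 17354885 889939602 (.node 17322629 225796626
  (.node 17318723 3895305 (.node 17306060 772499458 .leaf .leaf) .leaf) (.node 17330441 841230516
  (.node 17326535 6506267128 .leaf .leaf) .leaf)) (.node 17576519 134177057797 (.node 17572613
  6373731911 (.node 17568707 887180746390 .leaf .leaf) .leaf) (.node 17584331 877063856117 (.node
  17580425 6065037892 .leaf .leaf) .leaf))) (.node 17854853 724079306 (.node 17826503 36534305
  (.node 17625344 688219814 (.node 17600963 724827054763 .leaf .leaf) .leaf) (.node 17838221
  963560319 (.node 17834315 273497194 .leaf .leaf) .leaf)) (.node 18108743 825197300 (.node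
  18100931 724881695836 (.node 18092111 12698468584 .leaf .leaf) .leaf) (.node 18129218 258777314
  .leaf .leaf)))) (.node 18640904 5832510192 (.node 18616523 725265209075 (.node 18362633 505672792
  (.node 18358727 69526630 (.node 18354821 889939602 .leaf .leaf) .leaf) (.node 18612617 505672792
  (.node 18379202 5380807757 .leaf .leaf) .leaf)) (.node 18633092 5629104872 (.node 18625280
  6218083414 (.node 18620429 505672792 .leaf .leaf) .leaf) (.node 18636998 5714265173 .leaf
  .leaf))) (.node 19943555 822697505 (.node 19165316 24846993 (.node 19136966 656066092 (.node
  18886982 656066092 .leaf .leaf) .leaf) (.node 19665284 24846993 (.node 19411394 24846993 .leaf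
  .leaf) .leaf)) (.node 20197445 12259906482 (.node 20193539 376074822 (.node 20189633 980799327
  .leaf .leaf) .leaf) (.node 20447429 257823371 .leaf .leaf)))))) (.node 50377154 2177084532 (.node
  34869389 108928063 (.node 34091087 10621084505 (.node 33825479 268605590 (.node 33583307 51147634
  (.node 33575495 858007040 (.node 33567683 57499340 .leaf .leaf) .leaf) (.node 33821573 541843546
  (.node 33599939 710127707 .leaf .leaf) .leaf)) (.node 33853829 710127707 (.node 33837197
  274765266 (.node 33833291 1064801939 .leaf .leaf) .leaf) (.node 34083275 87165890 (.node 33878210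
  910200406 .leaf .leaf) .leaf))) (.node 34365515 505672792 (.node 34341071 10016756586 (.node
  34107719 889939602 (.node 34099907 889939602 .leaf .leaf) .leaf) (.node 34357703 889939602 (.node
  34353797 879772675 .leaf .leaf) .leaf)) (.node 34615499 90162935 (.node 34385990 9949932713
  (.node 34378178 2514744428 .leaf .leaf) .leaf) (.node 34865483 52550344 .leaf .leaf)))) (.node
  36442499 12845421982 (.node 35438657 740690096 (.node 34910402 879772675 (.node 34885958
  776593123 (.node 34878146 403263669 .leaf .leaf) .leaf) (.node 35418182 889939602 (.node 35393738
  3029853226 .leaf .leaf) .leaf)) (.node 36188609 12660005691 (.node 35942531 575015547 (.node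
  35938625 575015547 .leaf .leaf) .leaf) (.node 36196421 822697505 .leaf .leaf))) (.node 50336141
  963560319 (.node 36970817 486682256 (.node 36450311 305208312 (.node 36446405 738560892 .leaf
  .leaf) .leaf) (.node 37499072 11939721354 (.node 36974723 486682256 .leaf .leaf) .leaf)) (.node
  50356679 724079306 (.node 50352773 889939602 (.node 50340047 9752554468 .leaf .leaf) .leaf)
  (.node 50360585 505672792 .leaf .leaf))))) (.node 51392714 2799266392 (.node 50877122 1011305530
  (.node 50623232 6218083414 (.node 50610569 505672792 (.node 50606663 395222985771 (.node 50598851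
  1052051269650 .leaf .leaf) .leaf) (.node 50618381 505672792 (.node 50614475 1051227581158 .leaf
  .leaf) .leaf)) (.node 50864459 52550344 (.node 50634950 9949932713 (.node 50631044 337664024
  .leaf .leaf) .leaf) (.node 50868365 117784238 .leaf .leaf))) (.node 51134918 3326699712 (.node
  51122255 395541873339 (.node 50909378 889939602 (.node 50884934 7308950739 .leaf .leaf) .leaf)
  (.node 51131012 5752089615 (.node 51127106 6217527424 .leaf .leaf) .leaf)) (.node 51159362
  505672792 (.node 51142730 6408589410 (.node 51138824 5832510192 .leaf .leaf) .leaf) (.node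
  51163268 525915849 .leaf .leaf)))) (.node 51941507 461937166 (.node 51667142 889939602 (.node
  51642698 994105567 (.node 51437633 461937166 (.node 51409346 24846993 .leaf .leaf) .leaf) (.node
  51663236 24846993 (.node 51646604 688805549 .leaf .leaf) .leaf)) (.node 51917126 889939602 (.node
  51909314 889939602 (.node 51691523 934187710 .leaf .leaf) .leaf) (.node 51937601 461937166 .leaf
  .leaf))) (.node 52445381 257823371 (.node 52191491 916598935 (.node 52174922 505672792 (.node
  52167110 889939602 .leaf .leaf) .leaf) (.node 52441475 12172041495 (.node 52195397 916598935
  .leaf .leaf) .leaf)) (.node 52699271 71393243 (.node 52695365 12361309421 (.node 52449287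
  1045908650 .leaf .leaf) .leaf) (.node 53219777 908770394 .leaf .leaf))))))) (.node 101994944
  561254470 (.node 84676748 24846993 (.node 68952137 1064801939 (.node 67908290 24846993 (.node
  67371215 605117580 (.node 53751938 12675565751 (.node 53748032 875329597 (.node 53227589
  724079306 .leaf .leaf) .leaf) (.node 67121231 605117580 (.node 67113419 605117580 .leaf .leaf)
  .leaf)) (.node 67391690 739995699 (.node 67383878 589741718 (.node 67376066 589741718 .leaf
  .leaf) .leaf) (.node 67899470 739995699 (.node 67686593 36534305 .leaf .leaf) .leaf))) (.node
  68448263 420210972 (.node 68186561 860163006 (.node 67940483 12733680288 (.node 67936577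
  489790696 .leaf .leaf) .leaf) (.node 68444357 947911002 (.node 68440451 305208312 .leaf .leaf)
  .leaf)) (.node 68944325 117993417 (.node 68694341 6368702 (.node 68686529 858007040 .leaf .leaf)
  .leaf) (.node 68948231 690003092 .leaf .leaf)))) (.node 83939459 36534305 (.node 69480455
  789345964 (.node 69218753 789345964 (.node 68972675 505672792 (.node 68968769 505672792 .leaf
  .leaf) .leaf) (.node 69476549 789345964 (.node 69472643 789345964 .leaf .leaf) .leaf)) (.node
  83890634 1012713661 (.node 70004804 255708837 (.node 69996992 255708837 .leaf .leaf) .leaf)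
  (.node 83898446 1012713661 .leaf .leaf))) (.node 84422858 24846993 (.node 84185537 9984709768
  (.node 84161156 24846993 (.node 84148430 273135758 .leaf .leaf) .leaf) (.node 84193349 2863840970
  (.node 84189443 308100106 .leaf .leaf) .leaf)) (.node 84443333 36534305 (.node 84439427
  2112338791 (.node 84435521 3895305 .leaf .leaf) .leaf) (.node 84447239 36534305 .leaf .leaf)))))
  (.node 86257670 673646729 (.node 85217729 436670526 (.node 84939395 858007040 (.node 84693317
  8853209001 (.node 84689411 3895305 (.node 84685505 4129363435 .leaf .leaf) .leaf) (.node 84717761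
  724079306 (.node 84697223 10812363045 .leaf .leaf) .leaf)) (.node 85197191 154285425 (.node
  84947207 891006937 (.node 84943301 308298827 .leaf .leaf) .leaf) (.node 85205003 70733388 (.node
  85201097 10357267415 .leaf .leaf) .leaf))) (.node 85745984 258777314 (.node 85471619 789345964
  (.node 85225541 69526630 (.node 85221635 505672792 .leaf .leaf) .leaf) (.node 85729415 825197300
  (.node 85725509 889939602 .leaf .leaf) .leaf)) (.node 86249858 673646729 (.node 85995968
  656066092 (.node 85749890 258777314 .leaf .leaf) .leaf) (.node 86253764 656066092 .leaf .leaf))))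
  (.node 101192261 822697505 (.node 100942277 326245871 (.node 100692293 828928927 (.node 100684481
  36534305 (.node 87560321 1045908650 .leaf .leaf) .leaf) (.node 100938371 191272687 (.node
  100934465 155971278 .leaf .leaf) .leaf)) (.node 100966721 505672792 (.node 100950089 722330805
  (.node 100946183 572157552 .leaf .leaf) .leaf) (.node 100970627 505672792 .leaf .leaf))) (.node
  101494976 12513734249 (.node 101453963 12426574978 (.node 101450057 343568934 (.node 101200073
  12630363812 .leaf .leaf) .leaf) (.node 101478407 505672792 (.node 101474501 505672792 .leaf
  .leaf) .leaf)) (.node 101978375 52550344 (.node 101974469 741190756 (.node 101724485 789345964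
  .leaf .leaf) .leaf) (.node 101982281 52550344 .leaf .leaf)))))) (.node 152567879 225667754 (.node
  118255622 11262820376 (.node 117723461 436670526 (.node 117445127 858007040 (.node 103559297
  422863053 (.node 102502724 776593123 (.node 102002756 561254470 .leaf .leaf) .leaf) (.node
  117441221 36534305 (.node 103813187 222890529 .leaf .leaf) .leaf)) (.node 117702923 70733388
  (.node 117452939 12358070990 (.node 117449033 273497194 .leaf .leaf) .leaf) (.node 117715649
  69526630 (.node 117706829 2645826367 .leaf .leaf) .leaf))) (.node 117993920 1318699216 (.node
  117747842 12457922187 (.node 117743936 258777314 (.node 117727367 505672792 .leaf .leaf) .leaf)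
  (.node 117977351 52550344 (.node 117973445 741190756 .leaf .leaf) .leaf)) (.node 118247810
  1877856406 (.node 118235147 52550344 (.node 118231241 52550344 .leaf .leaf) .leaf) (.node
  118251716 11780034654 .leaf .leaf)))) (.node 120062147 1010848768 (.node 119287814 505672792
  (.node 118755590 352912956 (.node 118751684 475668211 (.node 118501700 656066092 .leaf .leaf)
  .leaf) (.node 119283908 505672792 (.node 118759496 994105567 .leaf .leaf) .leaf)) (.node
  119808257 376074822 (.node 119558273 257823371 (.node 119308289 934187710 .leaf .leaf) .leaf)
  (.node 119812163 945398576480 .leaf .leaf))) (.node 151806209 308694019 (.node 136057217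
  991004524 (.node 135557249 188412644 (.node 120066053 822697505 .leaf .leaf) .leaf) (.node
  136065029 808154504 (.node 136061123 9668954471 .leaf .leaf) .leaf)) (.node 152310083 225667754
  (.node 152056193 104827353 (.node 151810115 134771427108 .leaf .leaf) .leaf) (.node 152313989
  218463037 .leaf .leaf))))) (.node 185340227 395237783267 (.node 169091267 741190756 (.node
  168559043 10426280496 (.node 168059075 386594655 (.node 168055169 808154504 (.node 152838401
  505672792 .leaf .leaf) .leaf) (.node 168309059 9837078759 (.node 168062981 991004524 .leaf .leaf)
  .leaf)) (.node 168587393 505672792 (.node 168566855 976098312 (.node 168562949 188412644 .leaf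
  .leaf) .leaf) (.node 169087361 741190756 .leaf .leaf))) (.node 184811909 218463037 (.node
  184558019 10052464559 (.node 169619522 10477108463 (.node 169095173 741190756 .leaf .leaf) .leaf)
  (.node 184565831 225667754 (.node 184561925 104827353 .leaf .leaf) .leaf)) (.node 184840259
  395844541063 (.node 184836353 505672792 (.node 184815815 152375907989 .leaf .leaf) .leaf) (.node
  185086337 741190756 .leaf .leaf)))) (.node 202117442 739995699 (.node 186396800 505672792 (.node
  185864576 1026428597 (.node 185364608 425508583 (.node 185344133 741190756 .leaf .leaf) .leaf)
  (.node 185872388 1026428597 (.node 185868482 9887412826 .leaf .leaf) .leaf)) (.node 201596999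
  186460704 (.node 201589187 186460704 (.node 201339203 186460704 .leaf .leaf) .leaf) (.node
  201617474 739995699 .leaf .leaf))) (.node 219680771 225667754 (.node 218374214 928874146 (.node
  218366402 928874146 (.node 218116418 457576081 .leaf .leaf) .leaf) (.node 219676865 225667754
  (.node 219426881 10469895544 .leaf .leaf) .leaf)) (.node 251924801 10695378898 (.node 251678723
  225667754 (.node 251674817 225667754 .leaf .leaf) .leaf) (.node 251928707 225667754 .leaf
  .leaf)))))))

/-- The sources of hit polynomials of degree `23`. -/
def certTwentyThreeRows : List (List ℕ) :=
  [[68947968, 68186112, 3174400, 67170304, 68944000, 3932164], [117702660], [101449732],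
  [203161600], [18087942], [68186112, 3174400, 67170304], [1835076, 1835014], [68947968],
  [117448708], [68694016], [1581124], [84946944], [235159552], [3174400], [68186112], [135290944],
  [100945920], [1331202], [100691968], [33579076], [1077312, 1077250], [67895301], [83894277],
  [278535], [67137537], [1835076], [17834052], [33833028], [1077312], [24645], [68944000],
  [85196928], [100941952], [1073344], [67387521], [1327296], [251658496], [3674368], [101191936],
  [68686080], [135790912], [34079044], [117444864], [17830146], [49600], [100684032], [1065408],
  [16777479], [67637505], [20739], [50331972], [1577280], [33575232], [524613], [117440896],
  [1573312], [33571264], [83886465], [17826240], [16833], [36188160], [168304704], [36442112],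
  [52441088], [34078920], [565440], [19140609], [168558656], [34082888], [184557632], [50331848],
  [569408], [819392], [17076288], [151257153], [16781385], [33563328], [33567296], [33817280],
  [266817], [52695040], [184811584], [50335816], [17076226], [823360], [16822336], [151257091],
  [16781323], [2887681], [135004225], [528457], [18886657], [151003201], [17072320], [19136641],
  [16777417], [33821248], [266755], [12865], [262849], [103292992, 70787136, 102785088],
  [202649728, 235151616], [235151616], [218652672], [35172352], [70787136], [103292992], [553474],
  [17330178], [168845313], [35139585], [101449794], [117448770], [101195842], [67166274],
  [68182082], [67641411], [202903680], [234901632], [35422336], [50335878], [3674244], [68685956],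
  [168296644], [3416448], [19415424], [51421312], [67412352], [803458], [17580162], [100683908],
  [84434948], [549568], [35389569], [528519], [51388545], [35135617], [34627589], [34083012],
  [17326272], [33566986], [33829122], [68682050], [68428160], [84427136], [100933892], [33563080],
  [34619777], [270723], [33825216], [117444740], [84439040], [35389445], [34631681], [68943938],
  [1577156], [17326148], [100941890], [33575108], [100937984], [35131649], [33825092], [117440834],
  [1319360], [17318336], [85196866], [84692992], [17580100], [51642373], [34885633], [67387459],
  [17830084], [83890309], [20677], [1323328], [17322304], [51384577], [83886403], [67383553],
  [270661], [33828936], [184553664], [134746305], [270537], [34377729], [50376705], [50630657],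
  [52691010], [274505], [2883651], [19136579], [150999233], [17314368], [17564352], [17568320],
  [185098241], [119291906, 19423298, 51675202], [18665472], [235147648], [19669376], [33857921],
  [50917376], [35418368, 51663360, 51409408], [35418368], [51663360], [51933184], [84161280],
  [120848385], [51138561], [34107905], [19423298], [102531136], [51675202], [35422274], [70783168],
  [102781120], [219156546], [235409474], [35922242], [151789826], [51421250], [135279040],
  [84435010], [799490], [37486595], [51642435], [102498307], [37232705], [35135555], [34627651],
  [51167360], [235155584], [34115717], [103289024, 103288962], [100937860], [167784896, 167784834],
  [52183168], [35131525], [50880641], [103289024], [251658434], [119541890], [135540866],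
  [151539842], [117440710], [101191874], [68686018], [167784896], [33828998], [1323142],
  [17322118], [100683970], [795584], [83890371], [274629], [50872705], [67924224], [84681088],
  [815362, 807240], [34873729], [553412], [100933954], [815362], [17576256], [35127619],
  [100929924], [811456], [33821062], [17572226], [33567172], [35389507], [51388483], [50884609],
  [117444802], [33829060], [67637443], [274567], [51134593], [17576194], [17572288], [1323204],
  [52187136], [17322180], [102498369], [118497345], [67383429], [51384453], [51134469], [18378753],
  [18632705], [117444678], [84938946], [84688962], [118751297], [67637319], [83890247], [34881603],
  [67129539], [84685056], [17572164], [33821124], [815424], [17064384], [34877697], [12741],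
  [50876673], [17068352], [67379523], [51380547], [266693], [51929154], [52175232], [815238],
  [100676034], [102240387], [51163392], [135033024, 151531968, 151278016, 151285890, 151785858,
  151789764, 17576132], [119291968], [53231681, 53231619], [118493377, 118493315, 102240325,
  118489285], [102240449, 102240325], [185344257], [52977729], [119034048, 119284032, 118243393,
  117989441, 85483585, 53481665, 37228737, 85479617, 85729601, 117981505, 101474625, 118243331,
  53481603, 85479555, 85729539, 118489285, 117981381], [17608961], [103035072, 69480641, 101732545,
  101982529, 101978561, 101724609, 69480579, 101978499, 101982405], [85483585], [119284032,
  85729601, 101474625, 85729539], [118243393, 118243331], [101732545], [34353921], [117989441],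
  [50606849], [51167298], [235155522], [19669314], [151278016], [100937922, 100937798], [68432066,
  68431942], [52183106], [84431042, 84430918], [151285952, 135033024, 151285890, 84173122,
  84169154, 67916226, 83915202, 84172998], [185602115], [53231681], [17612867], [169349187],
  [84971713], [35131587, 35131463], [33857859], [17358915], [69472705], [201601091], [85737537],
  [118243393], [34357827], [51134531], [18374723], [50880579], [218902656], [103035072],
  [135033024], [151285952, 151285890], [151531968], [84684932], [151789764], [84177028], [815300],
  [17068228, 17068166], [169095297], [185094273], [37228737], [102240449], [52179200, 51671296,
  18624769, 18116865, 18620801, 51671172, 18370693, 18116741, 1863813, 18620677, 18362757],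
  [53481665, 53481603], [69480641, 69480579], [118489285], [17604993], [34877573], [18370693],
  [50876549], [50602881], [151285952], [3420354], [19419330], [51417282], [68432066], [17576132],
  [100937922], [84431042], [17068228], [53481665], [69480641], [118493377], [185598147],
  [201597123], [1609923], [35131587], [51384515], [2109891], [67383491], [34623683], [51671296],
  [52179200], [1863937], [101982529], [117981505], [18116865], [18624769, 18620801, 18620677],
  [34369793], [50868489], [18624769], [51130625], [84173122], [68424130], [84681026], [50872643],
  [34873667], [67121603, 67121479], [84676996], [807364], [16806340], [17314244], [18620801],
  [50618753], [34869637], [51126657], [100929986], [17568196], [67121603], [67375555], [119284032],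
  [101474625], [85729601], [119034048], [51671172], [117981381], [101724609], [1863813],
  [18116741], [101982405], [67916226], [83915202], [84169154], [85479617], [101978561],
  [152842369], [184840321], [185340289], [86782144], [218902594], [19165378], [1355971],
  [17354947], [17604931], [19665346], [18370755], [84177090], [36974785], [52973761], [101986497],
  [169095235], [185094211], [53223745], [33853891], [117985473], [50352835], [50602819],
  [18624645], [51130501], [50622597], [84684994], [34877635], [50876611], [18620739], [84677058],
  [118235457], [50618691], [34869699], [51126595], [51122565], [118780096], [119280064],
  [51663298], [68972737], [85471681], [101470657], [117469633], [1855939], [119288000, 119287938],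
  [101478593, 101478531], [117977537, 117977475], [119288000], [35418306], [51671234], [51917250],
  [52179138], [101478593], [85733507], [117731459], [1863875], [117977537], [34107843],
  [118239363], [18362819], [34369731], [50868675], [85225665, 85725633, 117723585, 51130563,
  18108867], [85225665], [85725633], [117723585], [51130563], [85733569], [118239425, 118239301],
  [117731521], [51130439], [18624707, 18624583], [18116803], [50622659, 50622535], [118239425],
  [18624707], [50622659], [118231489], [18616771], [50614723], [51122627]]

/-- The data for verifying the vanishing of invariants in degree `23`. -/
def certTwentyThree : Cert where
  deg := 23
  size := 565
  rank := 40
  mons := pack certTwentyThreeMons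
  index := certTwentyThreeIndex
  dual := certTwentyThreeDual
  rows := certTwentyThreeRows

theorem certNine_checkComplete : certNine.checkComplete = true := by decide +kernel

theorem certNine_checkDual : certNine.checkDual = true := by decide +kernel

theorem certNine_checkRows : certNine.checkRows certNine.rank certNine.rows = true := by
  decide +kernel

theorem certNine_checkRank : certNine.checkRank = true := by decide +kernel

theorem certTwentyThree_checkComplete : certTwentyThree.checkComplete = true := by decide +kernel

theorem certTwentyThree_checkDual : certTwentyThree.checkDual = true := by decide +kernel

theorem certTwentyThree_checkRows :
    certTwentyThree.checkRows certTwentyThree.rank certTwentyThree.rows = true := by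
  decide +kernel

theorem certTwentyThree_checkRank : certTwentyThree.checkRank = true := by decide +kernel

theorem mem_hits_of_invariant (s : ℕ) (f : P5) (hf : f.IsHomogeneous (14 * 2 ^ s - 5))
    (hinv : ∀ g, actGL g f - f ∈ hits Sq (14 * 2 ^ s - 5)) : f ∈ hits Sq (14 * 2 ^ s - 5) := by
  have h23 : ∀ f : P5, f.IsHomogeneous 23 → (∀ g, actGL g f - f ∈ hits Sq 23) → f ∈ hits Sq 23 :=
    fun f => mem_hits_of_invariant_of_cert (D := certTwentyThree) (by decide) (by decide)
      certTwentyThree_checkRows certTwentyThree_checkComplete certTwentyThree_checkDual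
      certTwentyThree_checkRank
  induction s using Nat.strong_induction_on generalizing f with
  | _ s ih =>
    obtain _ | _ | s := s
    · exact mem_hits_of_invariant_of_cert (D := certNine) (by decide) (by decide)
        certNine_checkRows certNine_checkComplete certNine_checkDual certNine_checkRank hf hinv
    · exact h23 f hf hinv
    · have h1 : 14 * 2 ^ (s + 1) - 5 = 28 * 2 ^ s - 5 := by omega
      have h2 : 14 * 2 ^ (s + 1 + 1) - 5 = 56 * 2 ^ s - 5 := by omega
      rw [h2] at hf hinv ⊢
      exact mem_hits_of_invariant_succ s (h1 ▸ ih (s + 1) (by omega)) hf hinv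

end Steenrod

/-- For every `s ≥ 1`, the `GL_5`-invariants of `(QP_5)_{7·2^s − 5}` vanish. -/
theorem stmt3 (s : ℕ) (hs : 1 ≤ s) (f : P5)
    (hf : f ∈ homogeneousSubmodule (Fin 5) (ZMod 2) (7 * 2 ^ s - 5))
    (hinv : ∀ g : Matrix.GeneralLinearGroup (Fin 5) (ZMod 2),
      IsHit (7 * 2 ^ s - 5) (actGL g f - f)) :
    IsHit (7 * 2 ^ s - 5) f := by
  obtain ⟨s, rfl⟩ := Nat.exists_eq_add_of_le' hs
  have h : 7 * 2 ^ (s + 1) - 5 = 14 * 2 ^ s - 5 := by omega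
  rw [h] at hf hinv ⊢
  exact (Steenrod.isHit_iff _ _).mpr (Steenrod.mem_hits_of_invariant s f hf fun g =>
    (Steenrod.isHit_iff _ _).mp (hinv g))
end
end

section
/- The GL_5-invariants of (QP_5)_2 vanish: every homogeneous polynomial f of degree 2 in P_5 such that g·f − f is hit for every g in GL_5(F_2) is itself hit. -/
open MvPolynomial

noncomputable section

/-- An exponent vector of total degree `2` is a sum of two unit vectors. -/
lemma exists_single_add_single_of_degree_eq_two {σ : Type*} {d : σ →₀ ℕ} (hd : d.degree = 2) :
    ∃ a b, d = Finsupp.single a 1 + Finsupp.single b 1 := by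
  classical
  have hcard : (Finsupp.toMultiset d).card = 2 := by
    rw [Finsupp.card_toMultiset, ← hd]
    rfl
  obtain ⟨a, b, hab⟩ := Multiset.card_eq_two.mp hcard
  refine ⟨a, b, Multiset.toFinsupp.symm.injective ?_⟩
  simp [hab]

/-- Exponent vectors of two quadratic monomials agree iff the index pairs agree up to order. -/
lemma single_add_single_eq_iff {σ : Type*} {a b c d : σ} :
    (Finsupp.single a 1 + Finsupp.single b 1 : σ →₀ ℕ) =
      Finsupp.single c 1 + Finsupp.single d 1 ↔ (a = c ∧ b = d) ∨ (a = d ∧ b = c) := by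
  rw [Finsupp.single_add_single_eq_single_add_single one_ne_zero one_ne_zero]
  simp

lemma coeff_X_mul_X {σ R : Type*} [DecidableEq σ] [CommSemiring R] (a b c d : σ) :
    coeff (Finsupp.single c 1 + Finsupp.single d 1) (X a * X b : MvPolynomial σ R) =
      if (a = c ∧ b = d) ∨ (a = d ∧ b = c) then 1 else 0 := by
  rw [X, X, monomial_mul, coeff_monomial]
  simp only [single_add_single_eq_iff, mul_one]

lemma coeff_single_add_single_X {σ R : Type*} [CommSemiring R] (a c d : σ) :
    coeff (Finsupp.single c 1 + Finsupp.single d 1) (X a : MvPolynomial σ R) = 0 := by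
  classical
  rw [coeff_X, if_neg]
  intro h
  have := congrArg Finsupp.degree h
  simp at this

lemma degree_single_add_single {σ : Type*} (a b : σ) :
    (Finsupp.single a 1 + Finsupp.single b 1 : σ →₀ ℕ).degree = 2 := by
  simp

/-- A hit polynomial of degree `2` has no mixed terms. -/
lemma IsHit.coeff_eq_zero {f : P5} (hf : IsHit 2 f) {i j : Fin 5} (hij : i ≠ j) :
    coeff (Finsupp.single i 1 + Finsupp.single j 1) f = 0 := by
  obtain ⟨g, hg, rfl⟩ := hf
  rw [coeff_homogeneousComponent, if_pos (degree_single_add_single i j), g.as_sum, map_sum,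
    coeff_sum]
  refine Finset.sum_eq_zero fun d hd => ?_
  have hlt : d.degree < 2 := by
    by_contra! hle
    have h := congrArg (coeff d) (hg d.degree hle)
    rw [coeff_homogeneousComponent, if_pos rfl, coeff_zero] at h
    exact mem_support_iff.mp hd h
  rw [← mul_one (coeff d g), ← smul_eq_mul, ← smul_monomial, map_smul, coeff_smul]
  suffices h : coeff (Finsupp.single i 1 + Finsupp.single j 1) (Sq (monomial d 1)) = 0 by
    rw [h, smul_zero]
  obtain h0 | h1 : d.degree = 0 ∨ d.degree = 1 := by lia
  · obtain rfl := (Finsupp.degree_eq_zero_iff d).mp h0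
    have : (0 : Fin 5 →₀ ℕ) ≠ Finsupp.single i 1 + Finsupp.single j 1 := by
      intro h
      have := congrArg Finsupp.degree h
      simp at this
    rw [monomial_zero', C_1, map_one, coeff_one, if_neg this]
  · obtain ⟨a, rfl⟩ := Finsupp.range_single_one.ge h1
    change coeff _ (Sq (X a)) = 0
    rw [Sq, aeval_X, sq, coeff_add, coeff_single_add_single_X, coeff_X_mul_X]
    grind

/-- A quadratic form without mixed terms is hit. -/
lemma isHit_two_of_coeff_eq_zero {f : P5} (hf : f.IsHomogeneous 2)
    (h : ∀ i j, i ≠ j → coeff (Finsupp.single i 1 + Finsupp.single j 1) f = 0) : IsHit 2 f := by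
  refine ⟨∑ i, coeff (Finsupp.single i 1 + Finsupp.single i 1) f • X i, fun m hm => ?_, ?_⟩
  · rw [map_sum]
    refine Finset.sum_eq_zero fun i _ => ?_
    rw [map_smul, homogeneousComponent_of_mem (isHomogeneous_X _ i), if_neg (by lia), smul_zero]
  · ext d
    rw [coeff_homogeneousComponent]
    split_ifs with hd
    · obtain ⟨a, b, rfl⟩ := exists_single_add_single_of_degree_eq_two hd
      simp only [map_sum, map_smul, Sq, aeval_X, coeff_sum, coeff_smul, coeff_add,
        coeff_single_add_single_X, sq, coeff_X_mul_X, zero_add, smul_eq_mul]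
      by_cases hab : a = b
      · subst hab
        simp
      · rw [h a b hab]
        refine (Finset.sum_eq_zero fun i _ => ?_).symm
        rw [if_neg (by grind), mul_zero]
    · exact hf.coeff_eq_zero hd

/-- The transvection substituting `x_i + x_k` for `x_i`. -/
def transvectionGL (i k : Fin 5) (hik : i ≠ k) : Matrix.GeneralLinearGroup (Fin 5) (ZMod 2) :=
  Matrix.GeneralLinearGroup.mkOfDetNeZero (Matrix.transvection i k 1)
    (by rw [Matrix.det_transvection_of_ne i k hik]; exact one_ne_zero)

lemma actGL_transvectionGL_X {i k : Fin 5} (hik : i ≠ k) (a : Fin 5) :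
    actGL (transvectionGL i k hik) (X a) = X a + if a = i then X k else 0 := by
  rw [actGL, aeval_X]
  change ∑ j, (Matrix.transvection i k (1 : ZMod 2)) a j • (X j : P5) = _
  simp only [Matrix.transvection, Matrix.add_apply, Matrix.one_apply, Matrix.single_apply,
    add_smul, Finset.sum_add_distrib, ite_smul, one_smul, zero_smul, Finset.sum_ite_eq,
    Finset.mem_univ, if_true]
  by_cases h : a = i
  · subst h
    simp
  · simp [h, Ne.symm h]

/-- Effect of a transvection on a mixed coefficient of a quadratic form. -/
lemma coeff_actGL_transvectionGL {f : P5} (hf : f.IsHomogeneous 2) {i j k : Fin 5}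
    (hij : i ≠ j) (hik : i ≠ k) (hjk : j ≠ k) :
    coeff (Finsupp.single k 1 + Finsupp.single j 1) (actGL (transvectionGL i k hik) f) =
      coeff (Finsupp.single k 1 + Finsupp.single j 1) f +
        coeff (Finsupp.single i 1 + Finsupp.single j 1) f := by
  rw [f.as_sum]
  simp only [map_sum, coeff_sum, ← Finset.sum_add_distrib]
  refine Finset.sum_congr rfl fun d hd => ?_
  have hdeg : d.degree = 2 := by
    by_contra h
    exact mem_support_iff.mp hd (hf.coeff_eq_zero h)
  obtain ⟨a, b, rfl⟩ := exists_single_add_single_of_degree_eq_two hdeg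
  have hmon (c : ZMod 2) : (monomial (Finsupp.single a 1 + Finsupp.single b 1) c : P5) =
      c • (X a * X b) := by
    rw [X, X, monomial_mul, smul_monomial]
    simp
  rw [hmon]
  simp only [map_smul, coeff_smul, ← smul_add, map_mul, actGL_transvectionGL_X]
  congr 1
  have hjk' := hjk.symm
  by_cases ha : a = i <;> by_cases hb : b = i <;>
    simp only [ha, hb, if_true, if_false, add_zero, mul_add, add_mul, coeff_add, coeff_X_mul_X] <;>
    grind

/-- The GL_5-invariants of (QP_5)_2 vanish. -/
theorem stmt4 (f : P5)
    (hf : f ∈ homogeneousSubmodule (Fin 5) (ZMod 2) 2)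
    (hinv : ∀ g : Matrix.GeneralLinearGroup (Fin 5) (ZMod 2), IsHit 2 (actGL g f - f)) :
    IsHit 2 f := by
  have hf' : f.IsHomogeneous 2 := (mem_homogeneousSubmodule 2 f).mp hf
  refine isHit_two_of_coeff_eq_zero hf' fun i j hij => ?_
  obtain ⟨k, hk⟩ : ∃ k, k ∉ ({i, j} : Finset (Fin 5)) := by
    by_contra! hall
    have hcard := (Finset.card_le_card fun x (_ : x ∈ Finset.univ) => hall x).trans
      Finset.card_le_two
    simp at hcard
  have hik : i ≠ k := by grind
  have hjk : j ≠ k := by grind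
  have hzero := (hinv (transvectionGL i k hik)).coeff_eq_zero hjk.symm
  rwa [coeff_sub, coeff_actGL_transvectionGL hf' hij hik hjk, add_sub_cancel_left] at hzero
end
end
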